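/- arXiv:1707.03701 — 3 statements merged into one kernel-verified Lean document; each statement's English description precedes it below -/
import Mathlib

section
/- For n ≥ 3, the set {f(P(n,2),M) : M a type-1 perfect matching of P(n,2)} is a set of consecutive integers (an integer interval). -/
open SimpleGraph

/-- Vertices of the generalized Petersen graph `P(n,2)`:
`Sum.inl i` is the outer vertex `u_i`, `Sum.inr i` is the inner vertex `v_i`. -/
abbrev PV (n : ℕ) := ZMod n ⊕ ZMod n

/-- The outer vertex `u_i`. -/
def pu {n : ℕ} (i : ZMod n) : PV n := Sum.inl i

/-- The inner vertex `v_i`. -/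
def pv {n : ℕ} (i : ZMod n) : PV n := Sum.inr i

/-- The generalized Petersen graph `P(n,2)`, with edges
`u_i u_{i+2}`, `u_i v_i` (spokes) and `v_i v_{i+1}`, indices mod `n`. -/
def petersen (n : ℕ) : SimpleGraph (PV n) :=
  SimpleGraph.fromRel (fun x y =>
    (∃ i : ZMod n, x = pu i ∧ y = pu (i + 2)) ∨
    (∃ i : ZMod n, x = pu i ∧ y = pv i) ∨
    (∃ i : ZMod n, x = pv i ∧ y = pv (i + 1)))

/-- `S` is a forcing set of the perfect matching `M` of `G`:
`S ⊆ M` and `S` is contained in no other perfect matching of `G`. -/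
def IsForcingSet {V : Type*} (G : SimpleGraph V) (M : G.Subgraph) (S : Set (Sym2 V)) : Prop :=
  S ⊆ M.edgeSet ∧
    ∀ M' : G.Subgraph, M'.IsPerfectMatching → S ⊆ M'.edgeSet → M' = M

/-- The forcing number `f(G,M)`: the minimum cardinality of a forcing set of `M`. -/
noncomputable def forcingNumber {V : Type*} (G : SimpleGraph V) (M : G.Subgraph) : ℕ :=
  sInf {k | ∃ S : Set (Sym2 V), IsForcingSet G M S ∧ S.ncard = k}

/-- Block `A` starting at position `i` (length 4). -/
def blockA (n : ℕ) (i : ZMod n) : Set (Sym2 (PV n)) :=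
  {s(pu i, pu (i + 2)), s(pu (i + 1), pu (i + 3)), s(pv i, pv (i + 1)), s(pv (i + 2), pv (i + 3))}

/-- Block `B` at position `i` (length 1): a single spoke. -/
def blockB (n : ℕ) (i : ZMod n) : Set (Sym2 (PV n)) :=
  {s(pu i, pv i)}

/-- Block `C` starting at position `i` (length 3). -/
def blockC (n : ℕ) (i : ZMod n) : Set (Sym2 (PV n)) :=
  {s(pu i, pu (i + 2)), s(pu (i + 1), pv (i + 1)), s(pv (i + 2), pv (i + 3))}

/-- Block `D` starting at position `i` (length 4). -/
def blockD (n : ℕ) (i : ZMod n) : Set (Sym2 (PV n)) :=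
  {s(pu i, pu (i + 2)), s(pu (i + 1), pu (i + 3)), s(pv (i + 1), pv (i + 2)), s(pv (i + 3), pv (i + 4))}

/-- Length of an `A`/`B` block: `true` codes `A` (length 4), `false` codes `B` (length 1). -/
def abLen (b : Bool) : ℕ := if b then 4 else 1

/-- Edge set of a concatenation of `A`/`B` blocks starting at position `i`. -/
def abEdges (n : ℕ) : ZMod n → List Bool → Set (Sym2 (PV n))
  | _, [] => ∅
  | i, true :: L => blockA n i ∪ abEdges n (i + 4) L
  | i, false :: L => blockB n i ∪ abEdges n (i + 1) L

/-- A perfect matching (given as a subgraph of `P(n,2)`) has type 1 if its edge set is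
a cyclic concatenation of `A` and `B` blocks whose lengths sum to `n`. -/
def IsType1 {n : ℕ} (M : (petersen n).Subgraph) : Prop :=
  ∃ (i : ZMod n) (L : List Bool), (L.map abLen).sum = n ∧ M.edgeSet = abEdges n i L

/-- Length of a `C`/`D` block: `true` codes `C` (length 3), `false` codes `D` (length 4). -/
def cdLen (b : Bool) : ℕ := if b then 3 else 4

/-- Edge set of a concatenation of `C`/`D` blocks starting at position `i`. -/
def cdEdges (n : ℕ) : ZMod n → List Bool → Set (Sym2 (PV n))
  | _, [] => ∅
  | i, true :: L => blockC n i ∪ cdEdges n (i + 3) L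
  | i, false :: L => blockD n i ∪ cdEdges n (i + 4) L

/-- A perfect matching (given as a subgraph of `P(n,2)`) has type 2 if its edge set is
a cyclic concatenation of `C` and `D` blocks whose lengths sum to `n`. -/
def IsType2 {n : ℕ} (M : (petersen n).Subgraph) : Prop :=
  ∃ (i : ZMod n) (L : List Bool), (L.map cdLen).sum = n ∧ M.edgeSet = cdEdges n i L

/-- Names for the edges of `P(n,2)`. -/
inductive PEdge (n : ℕ)
  /-- the edge `u_i u_{i+2}` -/
  | outer (i : ZMod n)
  /-- the edge `u_i v_i` -/
  | spoke (i : ZMod n)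
  /-- the edge `v_i v_{i+1}` -/
  | inner (i : ZMod n)

namespace PEdge

/-- Exactly one of three propositions holds. -/
def ExactlyOne (a b c : Prop) : Prop := (a ∨ b ∨ c) ∧ ¬(a ∧ b) ∧ ¬(a ∧ c) ∧ ¬(b ∧ c)

/-- A set of edge names covering every vertex of `P(n,2)` exactly once. -/
structure IsPM {n : ℕ} (X : Set (PEdge n)) : Prop where
  outer_vertex (i : ZMod n) : ExactlyOne (outer i ∈ X) (outer (i - 2) ∈ X) (spoke i ∈ X)
  inner_vertex (i : ZMod n) : ExactlyOne (inner i ∈ X) (inner (i - 1) ∈ X) (spoke i ∈ X)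

/-- The edge `u_k u_{k+2}` belongs to `X`. -/
def O {n : ℕ} (X : Set (PEdge n)) (k : ℤ) : Prop := outer (k : ZMod n) ∈ X

/-- The edge `v_k v_{k+1}` belongs to `X`. -/
def N {n : ℕ} (X : Set (PEdge n)) (k : ℤ) : Prop := inner (k : ZMod n) ∈ X

/-- The spoke `u_k v_k` belongs to `X`. -/
def S {n : ℕ} (X : Set (PEdge n)) (k : ℤ) : Prop := spoke (k : ZMod n) ∈ X

theorem IsPM.o {n : ℕ} {X : Set (PEdge n)} (h : IsPM X) (k : ℤ) :
    ExactlyOne (O X k) (O X (k - 2)) (S X k) := by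
  simpa [O, S] using h.outer_vertex k

theorem IsPM.i {n : ℕ} {X : Set (PEdge n)} (h : IsPM X) (k : ℤ) :
    ExactlyOne (N X k) (N X (k - 1)) (S X k) := by
  simpa [N, S] using h.inner_vertex k

/-- No edge of `X` joins positions smaller than `k` to positions at least `k`. -/
def Cut {n : ℕ} (X : Set (PEdge n)) (k : ℤ) : Prop :=
  ¬ O X (k - 1) ∧ ¬ O X (k - 2) ∧ ¬ N X (k - 1)

/-- `X` contains the block `A` at position `k`. -/
def Blk {n : ℕ} (X : Set (PEdge n)) (k : ℤ) : Prop :=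
  O X k ∧ O X (k + 1) ∧ N X k ∧ N X (k + 2)

/-- `X` has a position crossed by no edge; this characterizes type 1. -/
def HasCut {n : ℕ} (X : Set (PEdge n)) : Prop := ∃ k, Cut X k

section structure_lemmas

theorem IsPM.blk_cut {n : ℕ} {X : Set (PEdge n)} (h : IsPM X) {k : ℤ} (hb : Blk X k) :
    Cut X k ∧ Cut X (k + 4) := by
  have := h.o
  have := h.i
  grind [ExactlyOne, Blk, Cut]

theorem IsPM.cut_succ {n : ℕ} {X : Set (PEdge n)} (h : IsPM X) {k : ℤ} (hc : Cut X k) :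
    (S X k ∧ Cut X (k + 1)) ∨ Blk X k := by
  have := h.o
  have := h.i
  grind [ExactlyOne, Blk, Cut]

theorem IsPM.cut_pred {n : ℕ} {X : Set (PEdge n)} (h : IsPM X) {k : ℤ} (hc : Cut X k) :
    (S X (k - 1) ∧ Cut X (k - 1)) ∨ Blk X (k - 4) := by
  have := h.o
  have := h.i
  grind [ExactlyOne, Blk, Cut]

theorem IsPM.spoke_cut {n : ℕ} {X : Set (PEdge n)} (h : IsPM X) {k : ℤ} (hs : S X k)
    (ho : ¬ O X (k - 1)) : Cut X k ∧ Cut X (k + 1) := by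
  have := h.o
  have := h.i
  grind [ExactlyOne, Blk, Cut]

theorem IsPM.cut_or_blk {n : ℕ} {X : Set (PEdge n)} (h : IsPM X) (hX : HasCut X) (k : ℤ) :
    Cut X k ∨ Blk X (k - 1) ∨ Blk X (k - 2) ∨ Blk X (k - 3) := by
  obtain ⟨m, hm⟩ := hX
  induction k using Int.inductionOn' (b := m) with
  | zero => exact Or.inl hm
  | succ k _ ih =>
    have h1 := @IsPM.blk_cut n X h
    have h2 := @IsPM.cut_succ n X h k
    have h3 := @h1 (k - 3)
    grind
  | pred k _ ih =>
    have h1 := @IsPM.blk_cut n X h (k - 1)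
    have h2 := @IsPM.cut_pred n X h k
    grind

theorem IsPM.cut_of_spoke {n : ℕ} {X : Set (PEdge n)} (h : IsPM X) (hX : HasCut X) {k : ℤ}
    (hs : S X k) : Cut X k ∧ Cut X (k + 1) := by
  apply h.spoke_cut hs
  have := h.o
  have := h.i
  have := h.cut_or_blk hX k
  grind [ExactlyOne, Blk, Cut]

theorem IsPM.not_outer_of_spokes {n : ℕ} {X : Set (PEdge n)} (h : IsPM X) {k : ℤ}
    (hs : S X k) (hs' : S X (k + 1) ∨ S X (k + 2) ∨ S X (k + 4) ∨ S X (k + 5)) :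
    ¬ O X (k - 1) := by
  have h1 := h.o
  have h2 := h.i
  intro ho
  grind [ExactlyOne]

theorem IsPM.hasCut_of_spokes {n : ℕ} {X : Set (PEdge n)} (h : IsPM X) {k : ℤ}
    (hs : S X k) (hs' : S X (k + 1) ∨ S X (k + 2) ∨ S X (k + 4) ∨ S X (k + 5)) :
    HasCut X :=
  ⟨k, (h.spoke_cut hs (h.not_outer_of_spokes hs hs')).1⟩

theorem IsPM.eq_of_subset {n : ℕ} {X Y : Set (PEdge n)} (hX : IsPM X) (hY : IsPM Y)
    (h : X ⊆ Y) : Y = X := by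
  refine Set.Subset.antisymm (fun e he => ?_) h
  have ho := hX.outer_vertex
  have hi := hX.inner_vertex
  have ho' := hY.outer_vertex
  have hi' := hY.inner_vertex
  cases e with
  | outer i => grind [ExactlyOne]
  | spoke i => grind [ExactlyOne]
  | inner i => grind [ExactlyOne]

end structure_lemmas

/-- The edges of a block `A` at position `k`. -/
def aEdges {n : ℕ} (k : ZMod n) : Set (PEdge n) :=
  {outer k, outer (k + 1), inner k, inner (k + 2)}

/-- The four spokes at positions `k, …, k + 3`. -/
def bEdges {n : ℕ} (k : ZMod n) : Set (PEdge n) :=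
  {spoke k, spoke (k + 1), spoke (k + 2), spoke (k + 3)}

/-- Replace four consecutive spokes by a block `A`. -/
def toA {n : ℕ} (X : Set (PEdge n)) (k : ZMod n) : Set (PEdge n) := (X \ bEdges k) ∪ aEdges k

/-- Replace a block `A` by four consecutive spokes. -/
def toB {n : ℕ} (X : Set (PEdge n)) (k : ZMod n) : Set (PEdge n) := (X \ aEdges k) ∪ bEdges k

theorem aEdges_subset_iff {n : ℕ} {X : Set (PEdge n)} {k : ℤ} :
    aEdges (k : ZMod n) ⊆ X ↔ Blk X k := by
  simp [aEdges, Blk, O, N, Set.insert_subset_iff]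

theorem bEdges_subset_iff {n : ℕ} {X : Set (PEdge n)} {k : ℤ} :
    bEdges (k : ZMod n) ⊆ X ↔ S X k ∧ S X (k + 1) ∧ S X (k + 2) ∧ S X (k + 3) := by
  simp [bEdges, S, Set.insert_subset_iff]

theorem natCast_ne_zero {n m : ℕ} (h0 : 0 < m) (h : m < n) : ((m : ℕ) : ZMod n) ≠ 0 := by
  intro h'
  rw [ZMod.natCast_eq_zero_iff] at h'
  exact absurd (Nat.le_of_dvd h0 h') (by omega)

theorem small_ne_zero {n : ℕ} (hn : 5 ≤ n) :
    (1 : ZMod n) ≠ 0 ∧ (2 : ZMod n) ≠ 0 ∧ (3 : ZMod n) ≠ 0 ∧ (4 : ZMod n) ≠ 0 := by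
  refine ⟨?_, ?_, ?_, ?_⟩
  · exact_mod_cast natCast_ne_zero (n := n) (m := 1) (by omega) (by omega)
  · exact_mod_cast natCast_ne_zero (n := n) (m := 2) (by omega) (by omega)
  · exact_mod_cast natCast_ne_zero (n := n) (m := 3) (by omega) (by omega)
  · exact_mod_cast natCast_ne_zero (n := n) (m := 4) (by omega) (by omega)

section switching

variable {n : ℕ} {X : Set (PEdge n)} {i k : ZMod n}

theorem outer_mem_toA : outer i ∈ toA X k ↔ outer i ∈ X ∨ i - k = 0 ∨ i - k = 1 := by
  simp [toA, aEdges, bEdges, sub_eq_iff_eq_add, add_comm]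
  tauto

theorem inner_mem_toA : inner i ∈ toA X k ↔ inner i ∈ X ∨ i - k = 0 ∨ i - k = 2 := by
  simp [toA, aEdges, bEdges, sub_eq_iff_eq_add, add_comm]
  tauto

theorem spoke_mem_toA : spoke i ∈ toA X k ↔
    spoke i ∈ X ∧ ¬i - k = 0 ∧ ¬i - k = 1 ∧ ¬i - k = 2 ∧ ¬i - k = 3 := by
  simp [toA, aEdges, bEdges, sub_eq_iff_eq_add, add_comm]

theorem outer_mem_toB : outer i ∈ toB X k ↔ outer i ∈ X ∧ ¬i - k = 0 ∧ ¬i - k = 1 := by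
  simp [toB, aEdges, bEdges, sub_eq_iff_eq_add, add_comm]

theorem inner_mem_toB : inner i ∈ toB X k ↔ inner i ∈ X ∧ ¬i - k = 0 ∧ ¬i - k = 2 := by
  simp [toB, aEdges, bEdges, sub_eq_iff_eq_add, add_comm]

theorem spoke_mem_toB : spoke i ∈ toB X k ↔
    spoke i ∈ X ∨ i - k = 0 ∨ i - k = 1 ∨ i - k = 2 ∨ i - k = 3 := by
  simp [toB, aEdges, bEdges, sub_eq_iff_eq_add, add_comm]
  tauto

theorem shift_eqs (d : ZMod n) :
    (d - 1 = 0 ↔ d = 1) ∧ (d - 1 = 1 ↔ d = 2) ∧ (d - 1 = 2 ↔ d = 3) ∧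
      (d - 2 = 0 ↔ d = 2) ∧ (d - 2 = 1 ↔ d = 3) := by
  refine ⟨?_, ?_, ?_, ?_, ?_⟩ <;> rw [sub_eq_iff_eq_add] <;> norm_num

theorem small_ne (hn : 5 ≤ n) {d : ZMod n} : ¬(d = 0 ∧ d = 1) ∧ ¬(d = 0 ∧ d = 2) ∧
    ¬(d = 0 ∧ d = 3) ∧ ¬(d = 1 ∧ d = 2) ∧ ¬(d = 1 ∧ d = 3) ∧ ¬(d = 2 ∧ d = 3) := by
  obtain ⟨h1, h2, h3, h4⟩ := small_ne_zero hn
  have e : (3 : ZMod n) = 2 + 1 := by norm_num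
  have e' : (2 : ZMod n) = 1 + 1 := by norm_num
  refine ⟨?_, ?_, ?_, ?_, ?_, ?_⟩ <;> rintro ⟨rfl, h⟩
  · exact h1 h.symm
  · exact h2 h.symm
  · exact h3 h.symm
  · rw [e'] at h; exact h1 (by simpa using h)
  · rw [e, e', add_assoc] at h; exact h2 (by rw [e']; simpa using h)
  · rw [e] at h; exact h1 (by simpa using h)

theorem spoke_mem_of_bEdges (hk : bEdges k ⊆ X)
    (hi : i - k = 0 ∨ i - k = 1 ∨ i - k = 2 ∨ i - k = 3) : spoke i ∈ X := by
  apply hk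
  simpa [bEdges, sub_eq_iff_eq_add, add_comm] using hi

theorem outer_mem_of_aEdges (hk : aEdges k ⊆ X) (hi : i - k = 0 ∨ i - k = 1) : outer i ∈ X := by
  apply hk
  simpa [aEdges, sub_eq_iff_eq_add, add_comm] using hi

theorem inner_mem_of_aEdges (hk : aEdges k ⊆ X) (hi : i - k = 0 ∨ i - k = 2) : inner i ∈ X := by
  apply hk
  simpa [aEdges, sub_eq_iff_eq_add, add_comm] using hi

theorem IsPM.toA (hn : 5 ≤ n) (h : IsPM X) (hk : bEdges k ⊆ X) : IsPM (toA X k) := by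
  constructor <;> intro i
  all_goals
    have hs := @spoke_mem_of_bEdges n X i k hk
    have := @small_ne n hn (i - k)
    obtain ⟨e1, e2, e3, e4, e5⟩ := shift_eqs (i - k)
  · have := h.outer_vertex i
    rw [outer_mem_toA, outer_mem_toA, spoke_mem_toA, sub_right_comm, e4, e5]
    clear e1 e2 e3 e4 e5 hk
    generalize (i - k = 0) = p0 at *
    generalize (i - k = 1) = p1 at *
    generalize (i - k = 2) = p2 at *
    generalize (i - k = 3) = p3 at *
    grind [ExactlyOne]
  · have := h.inner_vertex i
    rw [inner_mem_toA, inner_mem_toA, spoke_mem_toA, sub_right_comm, e1, e3]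
    clear e1 e2 e3 e4 e5 hk
    generalize (i - k = 0) = p0 at *
    generalize (i - k = 1) = p1 at *
    generalize (i - k = 2) = p2 at *
    generalize (i - k = 3) = p3 at *
    grind [ExactlyOne]

theorem IsPM.toB (hn : 5 ≤ n) (h : IsPM X) (hk : aEdges k ⊆ X) : IsPM (toB X k) := by
  constructor <;> intro i
  all_goals
    have := @small_ne n hn (i - k)
    obtain ⟨e1, e2, e3, e4, e5⟩ := shift_eqs (i - k)
  · have := h.outer_vertex i
    have h1 := @outer_mem_of_aEdges n X i k hk
    have h2 := @outer_mem_of_aEdges n X (i - 2) k hk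
    rw [sub_right_comm, e4, e5] at h2
    rw [outer_mem_toB, outer_mem_toB, spoke_mem_toB, sub_right_comm, e4, e5]
    clear e1 e2 e3 e4 e5 hk
    generalize (i - k = 0) = p0 at *
    generalize (i - k = 1) = p1 at *
    generalize (i - k = 2) = p2 at *
    generalize (i - k = 3) = p3 at *
    grind [ExactlyOne]
  · have := h.inner_vertex i
    have h1 := @inner_mem_of_aEdges n X i k hk
    have h2 := @inner_mem_of_aEdges n X (i - 1) k hk
    rw [sub_right_comm, e1, e3] at h2
    rw [inner_mem_toB, inner_mem_toB, spoke_mem_toB, sub_right_comm, e1, e3]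
    clear e1 e2 e3 e4 e5 hk
    generalize (i - k = 0) = p0 at *
    generalize (i - k = 1) = p1 at *
    generalize (i - k = 2) = p2 at *
    generalize (i - k = 3) = p3 at *
    grind [ExactlyOne]

theorem disjoint_aEdges_of_bEdges (h : IsPM X) (hk : bEdges k ⊆ X) : Disjoint X (aEdges k) := by
  rw [Set.disjoint_left]
  intro e he ha
  have hs := @spoke_mem_of_bEdges n X (k + 2) k hk (by simp)
  have hs' := @spoke_mem_of_bEdges n X (k + 1) k hk (by simp)
  have hs'' := @spoke_mem_of_bEdges n X k k hk (by simp)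
  have h0 := h.outer_vertex k
  have h1 := h.outer_vertex (k + 1)
  have h2 := h.inner_vertex k
  have h3 := h.inner_vertex (k + 2)
  simp only [aEdges, Set.mem_insert_iff, Set.mem_singleton_iff] at ha
  rcases ha with rfl | rfl | rfl | rfl <;> grind [ExactlyOne]

theorem disjoint_bEdges_of_aEdges (h : IsPM X) (hk : aEdges k ⊆ X) : Disjoint X (bEdges k) := by
  rw [Set.disjoint_left]
  intro e he ha
  have hs := @outer_mem_of_aEdges n X k k hk (by simp)
  have hs' := @outer_mem_of_aEdges n X (k + 1) k hk (by simp)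
  have h0 := h.outer_vertex k
  have h1 := h.outer_vertex (k + 1)
  have h2 := h.outer_vertex (k + 2)
  have h3 := h.outer_vertex (k + 3)
  rw [show k + 2 - 2 = k by ring] at h2
  rw [show k + 3 - 2 = k + 1 by ring] at h3
  simp only [bEdges, Set.mem_insert_iff, Set.mem_singleton_iff] at ha
  rcases ha with rfl | rfl | rfl | rfl <;> grind [ExactlyOne]

theorem IsPM.toB_toA (h : IsPM X) (hk : bEdges k ⊆ X) : PEdge.toB (PEdge.toA X k) k = X := by
  have h1 := Set.disjoint_left.1 (disjoint_aEdges_of_bEdges h hk)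
  ext e
  simp only [PEdge.toB, PEdge.toA, Set.mem_union, Set.mem_sdiff]
  have := @hk e
  have := @h1 e
  by_cases e ∈ bEdges k <;> by_cases e ∈ aEdges k <;> by_cases e ∈ X <;> simp_all

end switching

section forcing

/-- `T` is a forcing set of the perfect matching `X`, in terms of edge names. -/
def Forces {n : ℕ} (X T : Set (PEdge n)) : Prop :=
  T ⊆ X ∧ ∀ Y, IsPM Y → T ⊆ Y → Y = X

/-- The forcing number of `X`, in terms of edge names. -/
noncomputable def fnum {n : ℕ} (X : Set (PEdge n)) : ℕ :=
  sInf {m | ∃ T, Forces X T ∧ T.ncard = m}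

instance {n : ℕ} [NeZero n] : Finite (PEdge n) := by
  refine Finite.of_surjective (α := ZMod n ⊕ ZMod n ⊕ ZMod n)
    (Sum.elim outer (Sum.elim spoke inner)) ?_
  rintro (i | i | i)
  · exact ⟨Sum.inl i, rfl⟩
  · exact ⟨Sum.inr (Sum.inl i), rfl⟩
  · exact ⟨Sum.inr (Sum.inr i), rfl⟩

variable {n : ℕ} {X T : Set (PEdge n)}

theorem IsPM.forces_self (h : IsPM X) : Forces X X :=
  ⟨subset_rfl, fun _ hY => h.eq_of_subset hY⟩

theorem IsPM.exists_forces (h : IsPM X) : ∃ T, Forces X T ∧ T.ncard = fnum X :=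
  Nat.sInf_mem (s := {m | ∃ T, Forces X T ∧ T.ncard = m}) ⟨_, X, h.forces_self, rfl⟩

theorem Forces.fnum_le (h : Forces X T) : fnum X ≤ T.ncard :=
  Nat.sInf_le ⟨T, h, rfl⟩

theorem Forces.inter_aEdges_nonempty (hn : 5 ≤ n) (hX : IsPM X) (h : Forces X T) {k : ZMod n}
    (hk : aEdges k ⊆ X) : (T ∩ aEdges k).Nonempty := by
  by_contra hne
  have hT : T ⊆ toB X k := fun e he =>
    Or.inl ⟨h.1 he, fun hek => hne ⟨e, he, hek⟩⟩
  have heq := h.2 _ (hX.toB hn hk) hT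
  have hs : spoke k ∈ toB X k := Or.inr (by simp [bEdges])
  rw [heq] at hs
  exact Set.disjoint_left.1 (disjoint_bEdges_of_aEdges hX hk) hs (by simp [bEdges])

theorem Forces.toB (hn : 5 ≤ n) (hX : IsPM X) (h : Forces X T) {k : ZMod n} (hk : aEdges k ⊆ X)
    {T' : Set (PEdge n)} (hT' : T' ⊆ toB X k)
    (hP : ∀ P, IsPM P → T' ⊆ P → bEdges k ⊆ P ∧ T \ aEdges k ⊆ P) : Forces (toB X k) T' := by
  refine ⟨hT', fun P hPM hTP => ?_⟩
  obtain ⟨hb, ha⟩ := hP P hPM hTP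
  have hd := Set.disjoint_left.1 (disjoint_bEdges_of_aEdges hX hk)
  have hT : T ⊆ toA P k := by
    intro e he
    by_cases hek : e ∈ aEdges k
    · exact Or.inr hek
    · exact Or.inl ⟨ha ⟨he, hek⟩, hd (h.1 he)⟩
  rw [← h.2 _ (hPM.toA hn hb) hT, hPM.toB_toA hb]

theorem IsPM.disjoint_aEdges (h : IsPM X) {a b : ℤ} (ha : Blk X a) (hb : Blk X b)
    (hab : (a : ZMod n) ≠ b) : Disjoint (aEdges (a : ZMod n)) (aEdges (b : ZMod n)) := by
  have key : ∀ {a b : ℤ}, Blk X a → Blk X b → (a : ZMod n) ≠ b + 1 := by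
    intro a b ha hb he
    have h1 : N X (b + 1) := by simpa [N, he] using ha.2.2.1
    have := h.i (b + 1)
    grind [ExactlyOne, Blk]
  have key' : ∀ {a b : ℤ}, Blk X a → Blk X b → (a : ZMod n) ≠ b + 2 := by
    intro a b ha hb he
    have h1 : O X (b + 2) := by simpa [O, he] using ha.1
    have := h.o (b + 2)
    grind [ExactlyOne, Blk]
  have h1 := key ha hb
  have h2 := key hb ha
  have h3 := key' ha hb
  have h4 := key' hb ha
  rw [Set.disjoint_left]
  rintro e he he'
  simp only [aEdges, Set.mem_insert_iff, Set.mem_singleton_iff] at he he'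
  rcases he with rfl | rfl | rfl | rfl <;> simp_all [eq_comm]

theorem ncard_sdiff_add_one_le {α : Type*} [Finite α] {T A : Set α} (hA : (T ∩ A).Nonempty) :
    (T \ A).ncard + 1 ≤ T.ncard := by
  obtain ⟨a, ha, ha'⟩ := hA
  rw [← Set.ncard_insert_of_notMem (a := a) (fun h => h.2 ha')]
  exact Set.ncard_le_ncard (Set.insert_subset ha Set.sdiff_subset)

theorem ncard_sdiff_add_two_le {α : Type*} [Finite α] {T A : Set α} {a b : α} (hab : a ≠ b)
    (ha : a ∈ T ∩ A) (hb : b ∈ T ∩ A) : (T \ A).ncard + 2 ≤ T.ncard := by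
  have h1 := ncard_sdiff_add_one_le (T := T \ {b}) (A := A) ⟨a, ⟨ha.1, hab⟩, ha.2⟩
  have h2 := ncard_sdiff_add_one_le (T := T) (A := {b}) ⟨b, hb.1, rfl⟩
  have h3 : (T \ {b}) \ A = T \ A := by
    ext x
    simp only [Set.mem_sdiff, Set.mem_singleton_iff]
    constructor
    · tauto
    · rintro ⟨hx, hxA⟩
      exact ⟨⟨hx, fun h => hxA (h ▸ hb.2)⟩, hxA⟩
  rw [h3] at h1
  omega

theorem ncard_union_insert_le {α : Type*} [Finite α] (s : Set α) (a b c : α) :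
    (s ∪ {a, b}).ncard ≤ s.ncard + 2 ∧ (s ∪ {a, b, c}).ncard ≤ s.ncard + 3 := by
  have h1 := Set.ncard_union_le s {a, b}
  have h2 := Set.ncard_union_le s {a, b, c}
  have h3 : ({a, b} : Set α).ncard ≤ 2 := Set.ncard_insert_le a {b} |>.trans (by simp)
  have h4 : ({a, b, c} : Set α).ncard ≤ 3 := Set.ncard_insert_le a {b, c} |>.trans (by
    have h3 : ({b, c} : Set α).ncard ≤ 2 := Set.ncard_insert_le b {c} |>.trans (by simp)
    omega)
  omega

end forcing

section replacing_a_block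

variable {n : ℕ} {X T : Set (PEdge n)} {j : ℤ}

theorem intCast_ne_add_four (hn : 5 ≤ n) (j : ℤ) : (j : ZMod n) ≠ ((j + 4 : ℤ) : ZMod n) := by
  have := (small_ne_zero hn).2.2.2
  simpa using this

theorem spoke_mem_of_mem_bEdges (k : ℤ) {e : PEdge n} (he : e ∈ bEdges (k : ZMod n))
    (heX : e ∈ X) (heT : e ∈ T) : (S X k ∧ S T k) ∨ (S X (k + 1) ∧ S T (k + 1)) ∨
      (S X (k + 2) ∧ S T (k + 2)) ∨ (S X (k + 3) ∧ S T (k + 3)) := by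
  simp only [bEdges, Set.mem_insert_iff, Set.mem_singleton_iff] at he
  rcases he with rfl | rfl | rfl | rfl <;> simp [S, *]

theorem toB_spokes (X : Set (PEdge n)) (j : ℤ) : S (toB X j) j ∧ S (toB X j) (j + 1) ∧
    S (toB X j) (j + 2) ∧ S (toB X j) (j + 3) :=
  bEdges_subset_iff.1 Set.subset_union_right

theorem exists_forces_toB_of_blk_blk (hn : 5 ≤ n) (hX : IsPM X) (hT : Forces X T)
    (h0 : Blk X j) (h4 : Blk X (j + 4)) :
    ∃ T', Forces (toB X (j : ZMod n)) T' ∧ T'.ncard ≤ T.ncard + 1 := by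
  have : NeZero n := ⟨by omega⟩
  have ha0 := aEdges_subset_iff.2 h0
  have ha4 := aEdges_subset_iff.2 h4
  have hd := hX.disjoint_aEdges h0 h4 (intCast_ne_add_four hn j)
  have hb := toB_spokes X j
  obtain ⟨x, hx⟩ := hT.inter_aEdges_nonempty hn hX ha0
  obtain ⟨y, hy⟩ := hT.inter_aEdges_nonempty hn hX ha4
  have hxy : x ≠ y := by
    rintro rfl
    exact Set.disjoint_left.1 hd hx.2 hy.2
  refine ⟨(T \ (aEdges (j : ZMod n) ∪ aEdges ((j + 4 : ℤ) : ZMod n))) ∪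
    {spoke (j : ZMod n), spoke ((j + 3 : ℤ) : ZMod n), outer ((j + 4 : ℤ) : ZMod n)},
    hT.toB hn hX ha0 ?_ ?_, ?_⟩
  · refine Set.union_subset (fun e he => Or.inl ⟨hT.1 he.1, fun h => he.2 (Or.inl h)⟩) ?_
    simp only [Set.insert_subset_iff, Set.singleton_subset_iff]
    refine ⟨hb.1, hb.2.2.2, Or.inl ⟨h4.1, Set.disjoint_right.1 hd (by simp [aEdges])⟩⟩
  · intro P hP hsub
    obtain ⟨hsub1, hsub2⟩ := Set.union_subset_iff.1 hsub
    simp only [Set.insert_subset_iff, Set.singleton_subset_iff] at hsub2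
    obtain ⟨s0, s3, o4⟩ := hsub2
    change S P j at s0
    change S P (j + 3) at s3
    change O P (j + 4) at o4
    have key : (S P j ∧ S P (j + 1) ∧ S P (j + 2) ∧ S P (j + 3)) ∧ Blk P (j + 4) := by
      have := hP.o
      have := hP.i
      grind [ExactlyOne, Blk]
    refine ⟨bEdges_subset_iff.2 key.1, fun e he => ?_⟩
    by_cases he4 : e ∈ aEdges ((j + 4 : ℤ) : ZMod n)
    · exact aEdges_subset_iff.2 key.2 he4
    · exact hsub1 ⟨he.1, by rintro (h | h); exacts [he.2 h, he4 h]⟩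
  · have h1 := ncard_sdiff_add_two_le hxy (A := aEdges (j : ZMod n) ∪ aEdges ((j + 4 : ℤ) : ZMod n))
      ⟨hx.1, Or.inl hx.2⟩ ⟨hy.1, Or.inr hy.2⟩
    have h2 := (ncard_union_insert_le
      (T \ (aEdges (j : ZMod n) ∪ aEdges ((j + 4 : ℤ) : ZMod n))) (spoke (j : ZMod n))
      (spoke ((j + 3 : ℤ) : ZMod n)) (outer ((j + 4 : ℤ) : ZMod n))).2
    omega

theorem exists_forces_toB_of_blk_spoke_blk (hn : 5 ≤ n) (hX : IsPM X) (hT : Forces X T)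
    (h0 : Blk X j) (h4 : S X (j + 4)) (h5 : Blk X (j + 5)) :
    ∃ T', Forces (toB X (j : ZMod n)) T' ∧ T'.ncard ≤ T.ncard + 1 := by
  have : NeZero n := ⟨by omega⟩
  have ha0 := aEdges_subset_iff.2 h0
  have ha5 := aEdges_subset_iff.2 h5
  have hb := toB_spokes X j
  have hs4 : spoke ((j + 4 : ℤ) : ZMod n) ∈ toB X j := Or.inl ⟨h4, by simp [aEdges]⟩
  obtain ⟨x, hx⟩ := hT.inter_aEdges_nonempty hn hX ha0
  obtain ⟨y, hy⟩ := hT.inter_aEdges_nonempty hn hX ha5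
  have spokes : ∀ P : Set (PEdge n), IsPM P → S P j → S P (j + 4) →
      S P j ∧ S P (j + 1) ∧ S P (j + 2) ∧ S P (j + 3) := by
    intro P hP s0 s4
    have hc := hP.hasCut_of_spokes s0 (by tauto)
    have h1 := hP.cut_of_spoke hc s0
    have h2 := hP.cut_of_spoke hc s4
    have := hP.o
    have := hP.i
    grind [ExactlyOne, Blk, Cut]
  by_cases h05 : (j : ZMod n) = ((j + 5 : ℤ) : ZMod n)
  · refine ⟨(T \ aEdges (j : ZMod n)) ∪
      {spoke (j : ZMod n), spoke ((j + 4 : ℤ) : ZMod n)}, hT.toB hn hX ha0 ?_ ?_, ?_⟩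
    · refine Set.union_subset (fun e he => Or.inl ⟨hT.1 he.1, he.2⟩) ?_
      simp only [Set.insert_subset_iff, Set.singleton_subset_iff]
      exact ⟨hb.1, hs4⟩
    · intro P hP hsub
      obtain ⟨hsub1, hsub2⟩ := Set.union_subset_iff.1 hsub
      simp only [Set.insert_subset_iff, Set.singleton_subset_iff] at hsub2
      exact ⟨bEdges_subset_iff.2 (spokes P hP hsub2.1 hsub2.2), hsub1⟩
    · have h1 := ncard_sdiff_add_one_le (T := T) (A := aEdges (j : ZMod n)) ⟨x, hx⟩
      have h2 := (ncard_union_insert_le (T \ aEdges (j : ZMod n)) (spoke (j : ZMod n))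
        (spoke ((j + 4 : ℤ) : ZMod n)) (spoke (j : ZMod n))).1
      omega
  have hd := hX.disjoint_aEdges h0 h5 h05
  have hxy : x ≠ y := by
    rintro rfl
    exact Set.disjoint_left.1 hd hx.2 hy.2
  refine ⟨(T \ (aEdges (j : ZMod n) ∪ aEdges ((j + 5 : ℤ) : ZMod n))) ∪
    {spoke (j : ZMod n), spoke ((j + 4 : ℤ) : ZMod n), outer ((j + 5 : ℤ) : ZMod n)},
    hT.toB hn hX ha0 ?_ ?_, ?_⟩
  · refine Set.union_subset (fun e he => Or.inl ⟨hT.1 he.1, fun h => he.2 (Or.inl h)⟩) ?_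
    simp only [Set.insert_subset_iff, Set.singleton_subset_iff]
    refine ⟨hb.1, hs4, Or.inl ⟨h5.1, Set.disjoint_right.1 hd (by simp [aEdges])⟩⟩
  · intro P hP hsub
    obtain ⟨hsub1, hsub2⟩ := Set.union_subset_iff.1 hsub
    simp only [Set.insert_subset_iff, Set.singleton_subset_iff] at hsub2
    obtain ⟨s0, s4, o5⟩ := hsub2
    change S P j at s0
    change S P (j + 4) at s4
    change O P (j + 5) at o5
    have key : Blk P (j + 5) := by
      have := hP.cut_of_spoke (hP.hasCut_of_spokes s0 (by tauto)) s4
      have := hP.o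
      have := hP.i
      grind [ExactlyOne, Blk, Cut]
    refine ⟨bEdges_subset_iff.2 (spokes P hP s0 s4), fun e he => ?_⟩
    by_cases he4 : e ∈ aEdges ((j + 5 : ℤ) : ZMod n)
    · exact aEdges_subset_iff.2 key he4
    · exact hsub1 ⟨he.1, by rintro (h | h); exacts [he.2 h, he4 h]⟩
  · have h1 := ncard_sdiff_add_two_le hxy (A := aEdges (j : ZMod n) ∪ aEdges ((j + 5 : ℤ) : ZMod n))
      ⟨hx.1, Or.inl hx.2⟩ ⟨hy.1, Or.inr hy.2⟩
    have h2 := (ncard_union_insert_le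
      (T \ (aEdges (j : ZMod n) ∪ aEdges ((j + 5 : ℤ) : ZMod n))) (spoke (j : ZMod n))
      (spoke ((j + 4 : ℤ) : ZMod n)) (outer ((j + 5 : ℤ) : ZMod n))).2
    omega

/-- If `T` has a single edge in a block `A` that can be shifted to position `k`,
then `T` contains a spoke of the shifted block. -/
theorem Forces.exists_spoke_of_shift (hn : 5 ≤ n) (hX : IsPM X) (hT : Forces X T)
    (h0 : Blk X j) {e : PEdge n} (hTe : ∀ x ∈ T ∩ aEdges (j : ZMod n), x = e) {k : ℤ}
    (he : e ∈ aEdges (k : ZMod n)) (hk : bEdges (k : ZMod n) ⊆ PEdge.toB X (j : ZMod n))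
    (hkX : (X ∩ bEdges (k : ZMod n)).Nonempty) :
    (S X k ∧ S T k) ∨ (S X (k + 1) ∧ S T (k + 1)) ∨
      (S X (k + 2) ∧ S T (k + 2)) ∨ (S X (k + 3) ∧ S T (k + 3)) := by
  have hB := hX.toB hn (aEdges_subset_iff.2 h0)
  have hA := hB.toA hn hk
  by_contra hcon
  have hsub : T ⊆ PEdge.toA (PEdge.toB X (j : ZMod n)) (k : ZMod n) := by
    intro x hx
    by_cases hxj : x ∈ aEdges (j : ZMod n)
    · exact Or.inr (hTe x ⟨hx, hxj⟩ ▸ he)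
    · exact Or.inl ⟨Or.inl ⟨hT.1 hx, hxj⟩,
        fun hxk => hcon (spoke_mem_of_mem_bEdges k hxk (hT.1 hx) hx)⟩
  have heq := hT.2 _ hA hsub
  obtain ⟨y, hy, hyk⟩ := hkX
  have : aEdges (k : ZMod n) ⊆ X := by
    rw [← heq]
    exact Set.subset_union_right
  exact Set.disjoint_left.1 (disjoint_bEdges_of_aEdges hX this) hy hyk

theorem exists_forces_toB_of_spokes (hn : 5 ≤ n) (hX : IsPM X) (hT : Forces X T)
    (h0 : Blk X j) (s1 : S X (j - 1)) (s2 : S X (j - 2)) (s4 : S X (j + 4)) (s5 : S X (j + 5)) :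
    ∃ T', Forces (toB X (j : ZMod n)) T' ∧ T'.ncard ≤ T.ncard + 1 := by
  have : NeZero n := ⟨by omega⟩
  have ha0 := aEdges_subset_iff.2 h0
  have hb := toB_spokes X j
  have hspoke : ∀ k : ℤ, S X k → S (toB X (j : ZMod n)) k := fun k hk => Or.inl ⟨hk, by simp [aEdges]⟩
  have spokes : ∀ P : Set (PEdge n), IsPM P → HasCut P → S P j → S P (j + 3) →
      S P j ∧ S P (j + 1) ∧ S P (j + 2) ∧ S P (j + 3) := by
    intro P hP hc s0 s3
    have h1 := hP.cut_of_spoke hc s0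
    have h2 := hP.cut_of_spoke hc s3
    have := hP.o
    have := hP.i
    grind [ExactlyOne, Blk, Cut]
  obtain ⟨x, hx⟩ := hT.inter_aEdges_nonempty hn hX ha0
  by_cases hone : ∀ y ∈ T ∩ aEdges (j : ZMod n), y = x
  · have hsp : S T (j - 2) ∨ S T (j - 1) ∨ S T (j + 4) ∨ S T (j + 5) := by
      have hsX : ¬ S X j ∧ ¬ S X (j + 1) ∧ ¬ S X (j + 2) ∧ ¬ S X (j + 3) := by
        have := hX.o
        grind [ExactlyOne, Blk]
      have hshift := @Forces.exists_spoke_of_shift n X T j hn hX hT h0 x hone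
      have sm1 := hspoke _ s1
      have sm2 := hspoke _ s2
      have sm4 := hspoke _ s4
      have sm5 := hspoke _ s5
      have hx' := hx.2
      simp only [aEdges, Set.mem_insert_iff, Set.mem_singleton_iff] at hx'
      rcases hx' with rfl | rfl | rfl | rfl
      · have := hshift (k := j - 1) (by simp [aEdges]) (bEdges_subset_iff.2 (by grind))
          ⟨spoke ((j - 1 : ℤ) : ZMod n), s1, by simp [bEdges]⟩
        grind
      · have := hshift (k := j + 1) (by simp [aEdges]) (bEdges_subset_iff.2 (by grind))
          ⟨spoke ((j + 4 : ℤ) : ZMod n), s4, by simp [bEdges]; ring_nf; tauto⟩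
        grind
      · have := hshift (k := j - 2) (by simp [aEdges]) (bEdges_subset_iff.2 (by grind))
          ⟨spoke ((j - 2 : ℤ) : ZMod n), s2, by simp [bEdges]⟩
        grind
      · have := hshift (k := j + 2) (by simp [aEdges]) (bEdges_subset_iff.2 (by grind))
          ⟨spoke ((j + 4 : ℤ) : ZMod n), s4, by simp [bEdges]; ring_nf; tauto⟩
        grind
    refine ⟨(T \ aEdges (j : ZMod n)) ∪
      {spoke (j : ZMod n), spoke ((j + 3 : ℤ) : ZMod n)}, hT.toB hn hX ha0 ?_ ?_, ?_⟩
    · refine Set.union_subset (fun e he => Or.inl ⟨hT.1 he.1, he.2⟩) ?_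
      simp only [Set.insert_subset_iff, Set.singleton_subset_iff]
      exact ⟨hb.1, hb.2.2.2⟩
    · intro P hP hsub
      obtain ⟨hsub1, hsub2⟩ := Set.union_subset_iff.1 hsub
      simp only [Set.insert_subset_iff, Set.singleton_subset_iff] at hsub2
      have hTP : ∀ k, S T k → S P k := fun k hk => hsub1 ⟨hk, by simp [aEdges]⟩
      obtain ⟨p0, p3⟩ := hsub2
      change S P j at p0
      change S P (j + 3) at p3
      have hc : HasCut P := by
        have h1 := @IsPM.hasCut_of_spokes n P hP j
        have h2 := @IsPM.hasCut_of_spokes n P hP (j - 2)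
        have h3 := @IsPM.hasCut_of_spokes n P hP (j - 1)
        grind
      exact ⟨bEdges_subset_iff.2 (spokes P hP hc p0 p3), hsub1⟩
    · have h1 := ncard_sdiff_add_one_le (T := T) (A := aEdges (j : ZMod n)) ⟨x, hx⟩
      have h2 := (ncard_union_insert_le (T \ aEdges (j : ZMod n)) (spoke (j : ZMod n))
        (spoke ((j + 3 : ℤ) : ZMod n)) (spoke (j : ZMod n))).1
      omega
  · push Not at hone
    obtain ⟨y, hy, hyx⟩ := hone
    refine ⟨(T \ aEdges (j : ZMod n)) ∪ {spoke (j : ZMod n), spoke ((j + 1 : ℤ) : ZMod n),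
      spoke ((j + 3 : ℤ) : ZMod n)}, hT.toB hn hX ha0 ?_ ?_, ?_⟩
    · refine Set.union_subset (fun e he => Or.inl ⟨hT.1 he.1, he.2⟩) ?_
      simp only [Set.insert_subset_iff, Set.singleton_subset_iff]
      exact ⟨hb.1, hb.2.1, hb.2.2.2⟩
    · intro P hP hsub
      obtain ⟨hsub1, hsub2⟩ := Set.union_subset_iff.1 hsub
      simp only [Set.insert_subset_iff, Set.singleton_subset_iff] at hsub2
      obtain ⟨p0, p1, p3⟩ := hsub2
      exact ⟨bEdges_subset_iff.2 (spokes P hP (hP.hasCut_of_spokes p0 (Or.inl p1)) p0 p3), hsub1⟩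
    · have h1 := ncard_sdiff_add_two_le hyx hy hx
      have h2 := (ncard_union_insert_le (T \ aEdges (j : ZMod n)) (spoke (j : ZMod n))
        (spoke ((j + 1 : ℤ) : ZMod n)) (spoke ((j + 3 : ℤ) : ZMod n))).2
      omega

end replacing_a_block

section spectrum

variable {n : ℕ} {X T : Set (PEdge n)}

/-- The perfect matching consisting of all spokes. -/
def allSpokes (n : ℕ) : Set (PEdge n) := Set.range spoke

theorem isPM_allSpokes (n : ℕ) : IsPM (allSpokes n) := by
  constructor <;> intro i <;> simp [allSpokes, ExactlyOne]

theorem IsPM.eq_allSpokes (h : IsPM X) (hX : ∀ i, spoke i ∈ X) : X = allSpokes n :=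
  (isPM_allSpokes n).eq_of_subset h (Set.range_subset_iff.2 hX)

theorem IsPM.exists_blk (h : IsPM X) (hc : HasCut X) {i : ZMod n} (hi : spoke i ∉ X) :
    ∃ j, Blk X j := by
  obtain ⟨k, rfl⟩ := ZMod.intCast_surjective i
  rcases h.cut_or_blk hc k with h1 | h1 | h1 | h1
  · exact ⟨k, (h.cut_succ h1).resolve_left fun h2 => hi h2.1⟩
  all_goals exact ⟨_, h1⟩

theorem IsPM.exists_fnum_toB_le (hn : 5 ≤ n) (h : IsPM X) {j : ℤ} (hj : Blk X j) :
    ∃ k : ℤ, Blk X k ∧ fnum (PEdge.toB X (k : ZMod n)) ≤ fnum X + 1 := by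
  obtain ⟨T, hT, hcard⟩ := h.exists_forces
  suffices ∃ k : ℤ, Blk X k ∧
      ∃ T', Forces (PEdge.toB X (k : ZMod n)) T' ∧ T'.ncard ≤ T.ncard + 1 by
    obtain ⟨k, hk, T', hT', hle⟩ := this
    exact ⟨k, hk, hcard ▸ hT'.fnum_le.trans hle⟩
  have hc := h.blk_cut hj
  rcases h.cut_succ hc.2 with ⟨s4, c5⟩ | b4
  swap
  · exact ⟨j, hj, exists_forces_toB_of_blk_blk hn h hT hj b4⟩
  rcases h.cut_succ c5 with ⟨s5, -⟩ | b5
  swap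
  · exact ⟨j, hj, exists_forces_toB_of_blk_spoke_blk hn h hT hj s4 (by convert b5 using 1; ring)⟩
  rcases h.cut_pred hc.1 with ⟨s1, c1⟩ | b1
  swap
  · exact ⟨j - 4, b1, exists_forces_toB_of_blk_blk hn h hT b1 (by convert hj using 1; ring)⟩
  rcases h.cut_pred c1 with ⟨s2, -⟩ | b2
  swap
  · exact ⟨_, b2, exists_forces_toB_of_blk_spoke_blk hn h hT b2
      (by convert s1 using 1; ring) (by convert hj using 1; ring)⟩
  exact ⟨j, hj, exists_forces_toB_of_spokes hn h hT hj s1 (by convert s2 using 1; ring) s4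
    (by convert s5 using 1; ring)⟩

theorem IsPM.exists_fnum_eq (hn : 5 ≤ n) (h : IsPM X) (hc : HasCut X) {k : ℕ}
    (hk : fnum X ≤ k) (hk' : k ≤ fnum (allSpokes n)) :
    ∃ Y : Set (PEdge n), IsPM Y ∧ HasCut Y ∧ fnum Y = k := by
  have : NeZero n := ⟨by omega⟩
  induction hm : {i : ZMod n | spoke i ∉ X}.ncard using Nat.strong_induction_on generalizing X with
  | _ m ih =>
    by_cases hall : ∀ i, spoke i ∈ X
    · rw [← h.eq_allSpokes hall] at hk'
      exact ⟨X, h, hc, le_antisymm hk hk'⟩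
    push Not at hall
    obtain ⟨i, hi⟩ := hall
    rcases hk.eq_or_lt with rfl | hlt
    · exact ⟨X, h, hc, rfl⟩
    obtain ⟨j₀, hj₀⟩ := h.exists_blk hc hi
    obtain ⟨j, hj, hle⟩ := h.exists_fnum_toB_le hn hj₀
    have hB := h.toB hn (aEdges_subset_iff.2 hj)
    have hs := toB_spokes X j
    refine ih _ ?_ hB (hB.hasCut_of_spokes hs.1 (Or.inl hs.2.1)) (by omega) rfl
    rw [← hm]
    refine Set.ncard_lt_ncard ⟨fun i hi hiX => hi (Or.inl ⟨hiX, by simp [aEdges]⟩), fun hsub => ?_⟩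
    refine hsub (a := (j : ZMod n)) (fun hjX => ?_) hs.1
    exact Set.disjoint_left.1 (disjoint_bEdges_of_aEdges h (aEdges_subset_iff.2 hj)) hjX
      (by simp [bEdges])

end spectrum

section bounds

variable {n : ℕ} {X T : Set (PEdge n)}

theorem le_four_mul_ncard_of_forces_allSpokes (hn : 5 ≤ n) (hT : Forces (allSpokes n) T) :
    n ≤ 4 * T.ncard := by
  have : NeZero n := ⟨by omega⟩
  set U : Set (ZMod n) := {i | spoke i ∈ T} with hU
  have hUT : spoke '' U = T := by
    ext e
    constructor
    · rintro ⟨i, hi, rfl⟩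
      exact hi
    · intro he
      obtain ⟨i, rfl⟩ := hT.1 he
      exact ⟨i, he, rfl⟩
  have hcard : U.ncard = T.ncard := by
    rw [← hUT, Set.ncard_image_of_injective _ (fun a b h => by simpa using h)]
  have hcover : (Set.univ : Set (ZMod n)) ⊆
      (U ∪ (fun i => i - 1) '' U) ∪ ((fun i => i - 2) '' U ∪ (fun i => i - 3) '' U) := by
    intro i _
    by_contra hcon
    have hb : bEdges i ⊆ allSpokes n := by
      simp [bEdges, Set.insert_subset_iff, allSpokes]
    have heq := hT.2 _ ((isPM_allSpokes n).toA hn hb) (fun e he => Or.inl ⟨hT.1 he, fun hei => ?_⟩)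
    · have h1 : outer i ∈ toA (allSpokes n) i := Or.inr (by simp [aEdges])
      rw [heq] at h1
      simp [allSpokes] at h1
    · apply hcon
      simp only [bEdges, Set.mem_insert_iff, Set.mem_singleton_iff] at hei
      rcases hei with rfl | rfl | rfl | rfl
      · exact Or.inl (Or.inl he)
      · exact Or.inl (Or.inr ⟨_, he, by simp⟩)
      · exact Or.inr (Or.inl ⟨_, he, by simp⟩)
      · exact Or.inr (Or.inr ⟨_, he, by simp⟩)
  have h0 := Set.ncard_le_ncard hcover
  rw [Set.ncard_univ, Nat.card_zmod] at h0
  have h1 := Set.ncard_union_le (U ∪ (fun i => i - 1) '' U)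
    ((fun i => i - 2) '' U ∪ (fun i => i - 3) '' U)
  have h2 := Set.ncard_union_le U ((fun i => i - 1) '' U)
  have h3 := Set.ncard_union_le ((fun i => i - 2) '' U) ((fun i => i - 3) '' U)
  have h4 := Set.ncard_image_le (f := fun i => i - 1) (Set.toFinite U)
  have h5 := Set.ncard_image_le (f := fun i => i - 2) (Set.toFinite U)
  have h6 := Set.ncard_image_le (f := fun i => i - 3) (Set.toFinite U)
  omega

/-- Every edge of `X` at position `k` belongs to `P`. -/
def AgreeAt (X P : Set (PEdge n)) (k : ℤ) : Prop :=
  (O X k → O P k) ∧ (N X k → N P k) ∧ (S X k → S P k)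

theorem IsPM.agreeAt_of_spoke {P : Set (PEdge n)} (hX : IsPM X) {k : ℤ} (h : S X k)
    (h' : S P k) : AgreeAt X P k := by
  have := hX.o k
  have := hX.i k
  grind [ExactlyOne, AgreeAt]

theorem IsPM.agreeAt_of_blk {P : Set (PEdge n)} (hX : IsPM X) {x k : ℤ} (h : Blk X x)
    (h' : Blk P x) (hk : x ≤ k) (hk' : k < x + 4) : AgreeAt X P k := by
  have := hX.o
  have := hX.i
  obtain rfl | rfl | rfl | rfl : k = x ∨ k = x + 1 ∨ k = x + 2 ∨ k = x + 3 := by omega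
  all_goals grind [ExactlyOne, AgreeAt, Blk]

/-- A segment of length `m` between two cuts of `X` can be reconstructed, given both cuts, from
at most `(m + c) / 4` edges, which moreover exclude blocks `A` entering the segment by at
least `4 - c` positions. -/
theorem IsPM.exists_segment (hX : IsPM X) {y : ℤ} (hy : Cut X y) (m : ℕ) :
    ∀ (x : ℤ) (c : ℕ), x + m = y → c ≤ 3 → Cut X x → ∃ T ⊆ X, 4 * T.ncard ≤ m + c ∧
      ∀ P, IsPM P → HasCut P → T ⊆ P → Cut P y →
        (Cut P x → ∀ k, x ≤ k → k < y → AgreeAt X P k) ∧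
        ∀ d : ℤ, 4 - c ≤ d → d ≤ 3 → ¬ Blk P (x + d - 4) := by
  have insert_card : ∀ (T : Set (PEdge n)) (e : PEdge n), (insert e T).ncard ≤ T.ncard + 1 :=
    fun T e => Set.ncard_insert_le e T
  induction m using Nat.strong_induction_on with
  | _ m ih =>
    intro x c hm hc hx
    rcases Nat.eq_zero_or_pos m with rfl | hpos
    · obtain rfl : x = y := by simpa using hm
      refine ⟨∅, Set.empty_subset _, by simp, fun P hP _ _ hcut =>
        ⟨fun _ k h1 h2 => absurd h1 (by omega), fun d h1 h2 hb => ?_⟩⟩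
      obtain rfl | rfl | rfl : d = 1 ∨ d = 2 ∨ d = 3 := by omega
      all_goals grind [Blk, Cut]
    rcases hX.cut_succ hx with ⟨hs, hx1⟩ | hb
    · by_cases hc3 : c = 3
      · subst hc3
        obtain ⟨T, hTX, hcard, hT⟩ := ih (m - 1) (by omega) (x + 1) 0 (by omega) (by omega) hx1
        refine ⟨insert (spoke (x : ZMod n)) T, Set.insert_subset hs hTX, ?_,
          fun P hP hPc hTP hPy => ?_⟩
        · have := insert_card T (spoke (x : ZMod n))
          omega
        obtain ⟨hsP, hTP⟩ := Set.insert_subset_iff.1 hTP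
        change S P x at hsP
        obtain ⟨h1, -⟩ := hT P hP hPc hTP hPy
        have hcs := hP.cut_of_spoke hPc hsP
        refine ⟨fun _ k hk hky => ?_, fun d hd hd' hbd => ?_⟩
        · rcases hk.eq_or_lt with rfl | hlt
          · exact hX.agreeAt_of_spoke hs hsP
          · exact h1 hcs.2 k (by omega) hky
        · obtain rfl | rfl | rfl : d = 1 ∨ d = 2 ∨ d = 3 := by omega
          all_goals grind [Blk, Cut]
      · obtain ⟨T, hTX, hcard, hT⟩ :=
          ih (m - 1) (by omega) (x + 1) (c + 1) (by omega) (by omega) hx1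
        refine ⟨T, hTX, by omega, fun P hP hPc hTP hPy => ?_⟩
        obtain ⟨h1, h2⟩ := hT P hP hPc hTP hPy
        refine ⟨fun hPx k hk hky => ?_, fun d hd hd' hbd => ?_⟩
        · have h3 := h2 3 (by omega) (by omega)
          rw [show x + 1 + 3 - 4 = x by ring] at h3
          obtain ⟨hsP, hPx1⟩ := (hP.cut_succ hPx).resolve_right h3
          rcases hk.eq_or_lt with rfl | hlt
          · exact hX.agreeAt_of_spoke hs hsP
          · exact h1 hPx1 k (by omega) hky
        · exact h2 (d - 1) (by push_cast; omega) (by omega) (by convert hbd using 1; ring)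
    · have hm4 : 4 ≤ m := by
        by_contra hlt
        obtain rfl | rfl | rfl : y = x + 1 ∨ y = x + 2 ∨ y = x + 3 := by omega
        all_goals
          have := hX.o
          grind [Blk, Cut]
      have hx4 := (hX.blk_cut hb).2
      obtain ⟨T, hTX, hcard, hT⟩ := ih (m - 4) (by omega) (x + 4) c (by omega) hc hx4
      have agree : ∀ P, IsPM P → Blk P x → (Cut P (x + 4) → ∀ k, x + 4 ≤ k → k < y →
          AgreeAt X P k) → ∀ k, x ≤ k → k < y → AgreeAt X P k := by
        intro P hP hPx h1 k hk hky
        by_cases hk4 : k < x + 4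
        · exact hX.agreeAt_of_blk hb hPx hk hk4
        · exact h1 (hP.blk_cut hPx).2 k (by omega) hky
      by_cases hc1 : c ≤ 1
      · refine ⟨insert (inner (x : ZMod n)) T, Set.insert_subset hb.2.2.1 hTX, ?_,
          fun P hP hPc hTP hPy => ?_⟩
        · have := insert_card T (inner (x : ZMod n))
          omega
        obtain ⟨hN, hTP⟩ := Set.insert_subset_iff.1 hTP
        change N P x at hN
        obtain ⟨h1, -⟩ := hT P hP hPc hTP hPy
        refine ⟨fun hPx => agree P hP ?_ h1, fun d hd hd' hbd => ?_⟩
        · refine (hP.cut_succ hPx).resolve_left fun h => ?_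
          have := hP.i x
          grind [ExactlyOne]
        · obtain rfl : d = 3 := by omega
          have := hP.i x
          grind [ExactlyOne, Blk]
      · refine ⟨insert (inner ((x + 2 : ℤ) : ZMod n)) T, Set.insert_subset hb.2.2.2 hTX, ?_,
          fun P hP hPc hTP hPy => ?_⟩
        · have := insert_card T (inner ((x + 2 : ℤ) : ZMod n))
          omega
        obtain ⟨hN, hTP⟩ := Set.insert_subset_iff.1 hTP
        change N P (x + 2) at hN
        obtain ⟨h1, h2⟩ := hT P hP hPc hTP hPy
        have h22 := h2 2 (by omega) (by omega)
        rw [show x + 4 + 2 - 4 = x + 2 by ring] at h22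
        have hi := hP.i (x + 2)
        have nc2 : ¬ Cut P (x + 2) := by
          intro h
          have := hP.cut_succ h
          grind [ExactlyOne]
        have nc1 : ¬ Cut P (x + 1) := by
          intro h
          have := hP.cut_succ h
          grind [ExactlyOne, Blk]
        refine ⟨fun hPx => agree P hP ?_ h1, fun d hd hd' hbd => ?_⟩
        · exact (hP.cut_succ hPx).resolve_left fun h => nc1 h.2
        · have hcut := (hP.blk_cut hbd).2
          obtain rfl | rfl | rfl : d = 1 ∨ d = 2 ∨ d = 3 := by omega
          · exact nc1 (by convert hcut using 1; ring)
          · exact nc2 (by convert hcut using 1; ring)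
          · grind [ExactlyOne, Blk]

theorem cut_add_natCast {k : ℤ} : Cut X (k + n) ↔ Cut X k := by
  simp [Cut, O, N]

theorem subset_of_agreeAt (hn : 5 ≤ n) {P : Set (PEdge n)} (j : ℤ)
    (h : ∀ k, j ≤ k → k < j + n → AgreeAt X P k) : X ⊆ P := by
  have : NeZero n := ⟨by omega⟩
  have rep : ∀ i : ZMod n, ∃ k : ℤ, (k : ZMod n) = i ∧ AgreeAt X P k := by
    intro i
    have hlt := ZMod.val_lt (i - (j : ZMod n))
    exact ⟨j + (i - (j : ZMod n)).val, by simp, h _ (by omega) (by omega)⟩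
  intro e he
  cases e with
  | outer i =>
    obtain ⟨k, rfl, hk⟩ := rep i
    exact hk.1 he
  | inner i =>
    obtain ⟨k, rfl, hk⟩ := rep i
    exact hk.2.1 he
  | spoke i =>
    obtain ⟨k, rfl, hk⟩ := rep i
    exact hk.2.2 he

theorem IsPM.four_mul_fnum_le_of_spoke (hn : 5 ≤ n) (hX : IsPM X) (hc : HasCut X) {j : ℤ}
    (hj : S X j) : 4 * fnum X ≤ n + 7 := by
  have : NeZero n := ⟨by omega⟩
  obtain ⟨hcj, hcj1⟩ := hX.cut_of_spoke hc hj
  obtain ⟨e, heX, he⟩ : ∃ e ∈ X, e = spoke ((j + 1 : ℤ) : ZMod n) ∨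
      e = outer ((j + 1 : ℤ) : ZMod n) := by
    rcases hX.cut_succ hcj1 with h | h
    · exact ⟨_, h.1, Or.inl rfl⟩
    · exact ⟨_, h.1, Or.inr rfl⟩
  obtain ⟨T, hTX, hcard, hT⟩ := hX.exists_segment (cut_add_natCast.2 hcj) (n - 1) (j + 1) 0
    (by omega) (by omega) hcj1
  have hF : Forces X (insert (spoke (j : ZMod n)) (insert e T)) := by
    refine ⟨Set.insert_subset hj (Set.insert_subset heX hTX), fun P hP hTP => ?_⟩
    simp only [Set.insert_subset_iff] at hTP
    obtain ⟨hs, heP, hTP⟩ := hTP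
    change S P j at hs
    have hno : ¬ O P (j - 1) := by
      rcases he with rfl | rfl
      · exact hP.not_outer_of_spokes hs (Or.inl heP)
      · change O P (j + 1) at heP
        have := hP.o (j + 1)
        grind [ExactlyOne]
    obtain ⟨hPj, hPj1⟩ := hP.spoke_cut hs hno
    obtain ⟨h1, -⟩ := hT P hP ⟨j, hPj⟩ hTP (cut_add_natCast.2 hPj)
    refine hX.eq_of_subset hP (subset_of_agreeAt hn j fun k hk hk' => ?_)
    rcases hk.eq_or_lt with rfl | hlt
    · exact hX.agreeAt_of_spoke hj hs
    · exact h1 hPj1 k (by omega) hk'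
  have h1 := hF.fnum_le
  have h2 := Set.ncard_insert_le (spoke (j : ZMod n)) (insert e T)
  have h3 := Set.ncard_insert_le e T
  omega

theorem IsPM.four_mul_fnum_le_of_forall_not_spoke (hn : 5 ≤ n) (hX : IsPM X) (hc : HasCut X)
    (hs : ∀ k, ¬ S X k) : 4 * fnum X ≤ n + 7 := by
  have : NeZero n := ⟨by omega⟩
  obtain ⟨j, hj⟩ := hc
  have hb := (hX.cut_succ hj).resolve_left fun h => hs _ h.1
  have hc4 := (hX.blk_cut hb).2
  have hb4 := (hX.cut_succ hc4).resolve_left fun h => hs _ h.1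
  have hc8 := (hX.blk_cut hb4).2
  have hn8 : 8 ≤ n := by
    by_contra hlt
    have hO : ∀ k : ℤ, O X (k + n) ↔ O X k := fun k => by simp [O]
    have hN : ∀ k : ℤ, N X (k + n) ↔ N X k := fun k => by simp [N]
    have hO' := hO (j - 2)
    have hN' := hN j
    have ho := hX.o
    have hi := hX.i
    obtain rfl | rfl | rfl : n = 5 ∨ n = 6 ∨ n = 7 := by omega
    all_goals
      push_cast at hO' hN'
      grind [ExactlyOne, Blk]
  obtain ⟨T, hTX, hcard, hT⟩ := hX.exists_segment (cut_add_natCast.2 hj) (n - 8) (j + 4 + 4) 0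
    (by omega) (by omega) hc8
  have hF : Forces X (insert (outer (j : ZMod n)) (insert (outer ((j + 1 : ℤ) : ZMod n))
      (insert (inner ((j + 4 : ℤ) : ZMod n)) T))) := by
    refine ⟨Set.insert_subset hb.1 (Set.insert_subset hb.2.1 (Set.insert_subset hb4.2.2.1 hTX)),
      fun P hP hTP => ?_⟩
    simp only [Set.insert_subset_iff] at hTP
    obtain ⟨o0, o1, i4, hTP⟩ := hTP
    change O P j at o0
    change O P (j + 1) at o1
    change N P (j + 4) at i4
    have hPb : Blk P j := by
      have := hP.o
      have := hP.i
      grind [ExactlyOne, Blk]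
    have hPc := hP.blk_cut hPb
    have hPb4 : Blk P (j + 4) := by
      refine (hP.cut_succ hPc.2).resolve_left fun h => ?_
      have := hP.i (j + 4)
      grind [ExactlyOne]
    obtain ⟨h1, -⟩ := hT P hP ⟨j, hPc.1⟩ hTP (cut_add_natCast.2 hPc.1)
    refine hX.eq_of_subset hP (subset_of_agreeAt hn j fun k hk hk' => ?_)
    by_cases hk4 : k < j + 4
    · exact hX.agreeAt_of_blk hb hPb hk hk4
    by_cases hk8 : k < j + 4 + 4
    · exact hX.agreeAt_of_blk hb4 hPb4 (by omega) hk8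
    exact h1 (hP.blk_cut hPb4).2 k (by omega) hk'
  have h1 := hF.fnum_le
  have h2 := Set.ncard_insert_le (outer (j : ZMod n)) (insert (outer ((j + 1 : ℤ) : ZMod n))
      (insert (inner ((j + 4 : ℤ) : ZMod n)) T))
  have h3 := Set.ncard_insert_le (outer ((j + 1 : ℤ) : ZMod n))
      (insert (inner ((j + 4 : ℤ) : ZMod n)) T)
  have h4 := Set.ncard_insert_le (inner ((j + 4 : ℤ) : ZMod n)) T
  omega

theorem IsPM.fnum_le_fnum_allSpokes_add_one (hn : 5 ≤ n) (hX : IsPM X) (hc : HasCut X) :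
    fnum X ≤ fnum (allSpokes n) + 1 := by
  obtain ⟨T, hT, hcard⟩ := (isPM_allSpokes n).exists_forces
  have h1 := le_four_mul_ncard_of_forces_allSpokes hn hT
  have h2 : 4 * fnum X ≤ n + 7 := by
    by_cases hs : ∃ j, S X j
    · obtain ⟨j, hj⟩ := hs
      exact hX.four_mul_fnum_le_of_spoke hn hc hj
    · exact hX.four_mul_fnum_le_of_forall_not_spoke hn hc (by simpa using hs)
  omega

theorem ordConnected_fnum (hn : 5 ≤ n) :
    Set.OrdConnected {k | ∃ X : Set (PEdge n), IsPM X ∧ HasCut X ∧ fnum X = k} := by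
  refine ⟨?_⟩
  rintro _ ⟨X, hX, hXc, rfl⟩ _ ⟨Y, hY, hYc, rfl⟩ k ⟨hk, hk'⟩
  by_cases hle : k ≤ fnum (allSpokes n)
  · exact hX.exists_fnum_eq hn hXc hk hle
  · have := hY.fnum_le_fnum_allSpokes_add_one hn hYc
    exact ⟨Y, hY, hYc, by omega⟩

end bounds

section bridge

variable {n : ℕ}

/-- The edge of `P(n,2)` with a given name. -/
def toSym2 : PEdge n → Sym2 (PV n)
  | outer i => s(pu i, pu (i + 2))
  | spoke i => s(pu i, pv i)
  | inner i => s(pv i, pv (i + 1))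

theorem toSym2_injective (hn : 5 ≤ n) : Function.Injective (toSym2 (n := n)) := by
  obtain ⟨h1, h2, h3, h4⟩ := small_ne_zero hn
  rintro (i | i | i) (j | j | j) h <;> simp [toSym2, pu, pv] at h ⊢
  · rcases h with h | ⟨rfl, h⟩
    · exact h
    · exact absurd (by linear_combination h) h4
  · exact h
  · rcases h with h | ⟨rfl, h⟩
    · exact h
    · exact absurd (by linear_combination h) h2

theorem petersen_adj_iff (hn : 3 ≤ n) {x y : PV n} :
    (petersen n).Adj x y ↔ s(x, y) ∈ Set.range (toSym2 (n := n)) := by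
  have h1 : (1 : ZMod n) ≠ 0 := by
    exact_mod_cast natCast_ne_zero (n := n) (m := 1) (by omega) (by omega)
  have h2 : (2 : ZMod n) ≠ 0 := by
    exact_mod_cast natCast_ne_zero (n := n) (m := 2) (by omega) (by omega)
  simp only [petersen, SimpleGraph.fromRel_adj]
  constructor
  · rintro ⟨-, (⟨i, rfl, rfl⟩ | ⟨i, rfl, rfl⟩ | ⟨i, rfl, rfl⟩) |
      (⟨i, rfl, rfl⟩ | ⟨i, rfl, rfl⟩ | ⟨i, rfl, rfl⟩)⟩
    · exact ⟨outer i, rfl⟩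
    · exact ⟨spoke i, rfl⟩
    · exact ⟨inner i, rfl⟩
    · exact ⟨outer i, Sym2.eq_swap⟩
    · exact ⟨spoke i, Sym2.eq_swap⟩
    · exact ⟨inner i, Sym2.eq_swap⟩
  · rintro ⟨i | i | i, h⟩
    all_goals
      simp only [toSym2, Sym2.eq_iff] at h
      rcases h with ⟨rfl, rfl⟩ | ⟨rfl, rfl⟩ <;> simp [pu, pv, h1, h2]

/-- The names of the edges of a subgraph. -/
def code (M : (petersen n).Subgraph) : Set (PEdge n) := toSym2 ⁻¹' M.edgeSet

/-- The spanning subgraph with given edge names. -/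
def ofCode (hn : 3 ≤ n) (X : Set (PEdge n)) : (petersen n).Subgraph where
  verts := Set.univ
  Adj x y := s(x, y) ∈ toSym2 '' X
  adj_sub := by
    rintro x y ⟨e, -, he⟩
    exact (petersen_adj_iff hn).2 ⟨e, he⟩
  edge_vert _ := Set.mem_univ _
  symm := ⟨fun x y h => by rwa [Sym2.eq_swap]⟩

theorem edgeSet_ofCode (hn : 3 ≤ n) (X : Set (PEdge n)) :
    (ofCode hn X).edgeSet = toSym2 '' X := by
  ext e
  induction e with
  | _ x y => rfl

theorem image_code (hn : 3 ≤ n) (M : (petersen n).Subgraph) : toSym2 '' code M = M.edgeSet := by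
  refine Set.image_preimage_eq_of_subset fun e he => ?_
  induction e with
  | _ x y => exact (petersen_adj_iff hn).1 (M.adj_sub he)

theorem code_ofCode (hn : 5 ≤ n) (X : Set (PEdge n)) : code (ofCode (by omega) X) = X := by
  rw [code, edgeSet_ofCode, Set.preimage_image_eq _ (toSym2_injective hn)]

theorem existsUnique_iff_exactlyOne {α : Type*} {a b c : α} {p q r : Prop} (hab : a ≠ b)
    (hac : a ≠ c) (hbc : b ≠ c) :
    (∃! w, (w = a ∧ p) ∨ (w = b ∧ q) ∨ (w = c ∧ r)) ↔ ExactlyOne p q r := by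
  constructor
  · rintro ⟨w, hw, huniq⟩
    have h1 := huniq a
    have h2 := huniq b
    have h3 := huniq c
    grind [ExactlyOne]
  · rintro ⟨h | h | h, h1, h2, h3⟩
    · exact ⟨a, by tauto, by grind⟩
    · exact ⟨b, by tauto, by grind⟩
    · exact ⟨c, by tauto, by grind⟩

theorem adj_pu_iff (hn : 3 ≤ n) (M : (petersen n).Subgraph) (i : ZMod n) (w : PV n) :
    M.Adj (pu i) w ↔ (w = pu (i + 2) ∧ outer i ∈ code M) ∨
      (w = pu (i - 2) ∧ outer (i - 2) ∈ code M) ∨ (w = pv i ∧ spoke i ∈ code M) := by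
  constructor
  · intro h
    obtain ⟨e, he⟩ := (petersen_adj_iff hn).1 (M.adj_sub h)
    have hmem : e ∈ code M := by
      rw [code, Set.mem_preimage, he]
      exact h
    cases e with
    | outer j =>
      simp only [toSym2, Sym2.eq_iff] at he
      rcases he with ⟨h1, rfl⟩ | ⟨rfl, h2⟩
      · obtain rfl : j = i := Sum.inl_injective h1
        exact Or.inl ⟨rfl, hmem⟩
      · obtain rfl : j + 2 = i := Sum.inl_injective h2
        rw [add_sub_cancel_right]
        exact Or.inr (Or.inl ⟨rfl, hmem⟩)
    | spoke j =>
      simp only [toSym2, Sym2.eq_iff] at he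
      rcases he with ⟨h1, rfl⟩ | ⟨rfl, h2⟩
      · obtain rfl : j = i := Sum.inl_injective h1
        exact Or.inr (Or.inr ⟨rfl, hmem⟩)
      · simp [pu, pv] at h2
    | inner j => simp [toSym2, pu, pv] at he
  · rintro (⟨rfl, h⟩ | ⟨rfl, h⟩ | ⟨rfl, h⟩)
    · exact h
    · change s(pu (i - 2), pu (i - 2 + 2)) ∈ M.edgeSet at h
      rw [sub_add_cancel, Sym2.eq_swap] at h
      exact h
    · exact h

theorem adj_pv_iff (hn : 3 ≤ n) (M : (petersen n).Subgraph) (i : ZMod n) (w : PV n) :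
    M.Adj (pv i) w ↔ (w = pv (i + 1) ∧ inner i ∈ code M) ∨
      (w = pv (i - 1) ∧ inner (i - 1) ∈ code M) ∨ (w = pu i ∧ spoke i ∈ code M) := by
  constructor
  · intro h
    obtain ⟨e, he⟩ := (petersen_adj_iff hn).1 (M.adj_sub h)
    have hmem : e ∈ code M := by
      rw [code, Set.mem_preimage, he]
      exact h
    cases e with
    | inner j =>
      simp only [toSym2, Sym2.eq_iff] at he
      rcases he with ⟨h1, rfl⟩ | ⟨rfl, h2⟩
      · obtain rfl : j = i := Sum.inr_injective h1
        exact Or.inl ⟨rfl, hmem⟩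
      · obtain rfl : j + 1 = i := Sum.inr_injective h2
        rw [add_sub_cancel_right]
        exact Or.inr (Or.inl ⟨rfl, hmem⟩)
    | spoke j =>
      simp only [toSym2, Sym2.eq_iff] at he
      rcases he with ⟨h1, rfl⟩ | ⟨rfl, h2⟩
      · simp [pu, pv] at h1
      · obtain rfl : j = i := Sum.inr_injective h2
        exact Or.inr (Or.inr ⟨rfl, hmem⟩)
    | outer j => simp [toSym2, pu, pv] at he
  · rintro (⟨rfl, h⟩ | ⟨rfl, h⟩ | ⟨rfl, h⟩)
    · exact h
    · change s(pv (i - 1), pv (i - 1 + 1)) ∈ M.edgeSet at h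
      rw [sub_add_cancel, Sym2.eq_swap] at h
      exact h
    · change s(pu i, pv i) ∈ M.edgeSet at h
      rw [Sym2.eq_swap] at h
      exact h

theorem isPerfectMatching_iff_isPM (hn : 5 ≤ n) (M : (petersen n).Subgraph) :
    M.IsPerfectMatching ↔ IsPM (code M) := by
  obtain ⟨-, h2, -, h4⟩ := small_ne_zero hn
  have houter : ∀ i : ZMod n, pu (i + 2) ≠ pu (i - 2) := by
    intro i h
    have h := Sum.inl_injective h
    exact h4 (by linear_combination h)
  have hinner : ∀ i : ZMod n, pv (i + 1) ≠ pv (i - 1) := by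
    intro i h
    have h := Sum.inr_injective h
    exact h2 (by linear_combination h)
  have ho : ∀ i, (∃! w, M.Adj (pu i) w) ↔ ExactlyOne (outer i ∈ code M) (outer (i - 2) ∈ code M)
      (spoke i ∈ code M) := fun i => by
    simp only [adj_pu_iff (show 3 ≤ n by omega)]
    exact existsUnique_iff_exactlyOne (houter i) (by simp [pu, pv]) (by simp [pu, pv])
  have hi : ∀ i, (∃! w, M.Adj (pv i) w) ↔ ExactlyOne (inner i ∈ code M) (inner (i - 1) ∈ code M)
      (spoke i ∈ code M) := fun i => by
    simp only [adj_pv_iff (show 3 ≤ n by omega)]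
    exact existsUnique_iff_exactlyOne (hinner i) (by simp [pu, pv]) (by simp [pu, pv])
  rw [Subgraph.isPerfectMatching_iff]
  constructor
  · intro h
    exact ⟨fun i => (ho i).1 (h _), fun i => (hi i).1 (h _)⟩
  · rintro h (i | i)
    · exact (ho i).2 (h.outer_vertex i)
    · exact (hi i).2 (h.inner_vertex i)

theorem isPerfectMatching_eq_of_edgeSet_subset {V : Type*} {G : SimpleGraph V}
    {M M' : G.Subgraph} (hM : M.IsPerfectMatching) (hM' : M'.IsPerfectMatching)
    (h : M.edgeSet ⊆ M'.edgeSet) : M' = M := by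
  have hsub : ∀ {v w}, M.Adj v w → M'.Adj v w := fun {v w} hvw => h (a := s(v, w)) hvw
  refine Subgraph.ext ?_ ?_
  · rw [Set.eq_univ_of_forall hM.2, Set.eq_univ_of_forall hM'.2]
  · ext v w
    refine ⟨fun hvw => ?_, hsub⟩
    obtain ⟨w', hw', -⟩ := Subgraph.isPerfectMatching_iff.1 hM v
    rwa [(Subgraph.isPerfectMatching_iff.1 hM' v).unique hvw (hsub hw')]

theorem forcingNumber_eq_fnum (hn : 5 ≤ n) {M : (petersen n).Subgraph}
    (hM : M.IsPerfectMatching) : forcingNumber (petersen n) M = fnum (code M) := by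
  have hn3 : 3 ≤ n := by omega
  have hinj := toSym2_injective hn
  rw [forcingNumber, fnum]
  congr 1
  ext m
  constructor
  · rintro ⟨U, ⟨hU, hforce⟩, rfl⟩
    have hUe : toSym2 '' (toSym2 ⁻¹' U) = U := by
      refine Set.image_preimage_eq_of_subset (hU.trans ?_)
      rw [← image_code hn3 M]
      exact Set.image_subset_range _ _
    refine ⟨toSym2 ⁻¹' U, ⟨Set.preimage_mono hU, fun Y hY hUY => ?_⟩, ?_⟩
    · have hYM := hforce (ofCode hn3 Y)
        ((isPerfectMatching_iff_isPM hn _).2 (by rwa [code_ofCode hn]))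
        (by rw [edgeSet_ofCode, ← hUe]; exact Set.image_mono hUY)
      rw [← hYM, code_ofCode hn]
    · rw [← Set.ncard_image_of_injective _ hinj, hUe]
  · rintro ⟨T, ⟨hT, hforce⟩, rfl⟩
    refine ⟨toSym2 '' T, ⟨Set.image_subset_iff.2 hT, fun M' hM' hTM' => ?_⟩,
      Set.ncard_image_of_injective _ hinj⟩
    have hcode := hforce (code M') ((isPerfectMatching_iff_isPM hn _).1 hM')
      (Set.image_subset_iff.1 hTM')
    refine isPerfectMatching_eq_of_edgeSet_subset hM hM' ?_
    rw [← image_code hn3 M, ← image_code hn3 M', hcode]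

theorem image_aEdges (i : ZMod n) : toSym2 '' aEdges i = blockA n i := by
  simp only [aEdges, blockA, Set.image_insert_eq, Set.image_singleton, toSym2]
  rw [show i + 1 + 2 = i + 3 by ring, show i + 2 + 1 = i + 3 by ring]

theorem image_spoke (i : ZMod n) : toSym2 '' {spoke i} = blockB n i := by
  simp [blockB, toSym2]

theorem blk_code {M : (petersen n).Subgraph} {i : ZMod n} (h : blockA n i ⊆ M.edgeSet) :
    ∃ k : ℤ, Blk (code M) k := by
  obtain ⟨k, rfl⟩ := ZMod.intCast_surjective i
  rw [← image_aEdges, Set.image_subset_iff] at h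
  exact ⟨k, aEdges_subset_iff.1 h⟩

theorem hasCut_of_isType1 (hn : 5 ≤ n) {M : (petersen n).Subgraph} (hM : IsPM (code M))
    (h : IsType1 M) : HasCut (code M) := by
  obtain ⟨i, L, hL, hE⟩ := h
  match L, hL, hE with
  | [], hL, _ => simp at hL; omega
  | [false], hL, _ => simp [abLen] at hL; omega
  | true :: L, _, hE =>
    obtain ⟨k, hk⟩ := blk_code (hE ▸ Set.subset_union_left : blockA n i ⊆ M.edgeSet)
    exact ⟨k, (hM.blk_cut hk).1⟩
  | false :: true :: L, _, hE =>
    obtain ⟨k, hk⟩ := blk_code (M := M) (i := i + 1)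
      (by rw [hE]; exact fun e he => Or.inr (Or.inl he))
    exact ⟨k, (hM.blk_cut hk).1⟩
  | false :: false :: L, _, hE =>
    obtain ⟨k, rfl⟩ := ZMod.intCast_surjective i
    refine hM.hasCut_of_spokes (k := k) ?_ (Or.inl ?_)
    · change s(_, _) ∈ M.edgeSet
      rw [hE]
      exact Or.inl rfl
    · change s(_, _) ∈ M.edgeSet
      rw [hE]
      refine Or.inr (Or.inl ?_)
      simp [blockB]

/-- The edges of `X` at positions `i, …, i + m - 1`. -/
def seg (X : Set (PEdge n)) (i : ℤ) (m : ℕ) : Set (PEdge n) :=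
  {e | e ∈ X ∧ ∃ k : ℤ, i ≤ k ∧ k < i + m ∧
    (e = outer (k : ZMod n) ∨ e = spoke (k : ZMod n) ∨ e = inner (k : ZMod n))}

theorem seg_add (X : Set (PEdge n)) (i : ℤ) (a b : ℕ) :
    seg X i (a + b) = seg X i a ∪ seg X (i + a) b := by
  ext e
  simp only [seg, Set.mem_ofPred_eq, Set.mem_union]
  constructor
  · rintro ⟨he, k, h1, h2, h3⟩
    by_cases hk : k < i + a
    · exact Or.inl ⟨he, k, h1, hk, h3⟩
    · exact Or.inr ⟨he, k, by omega, by push_cast at h2; omega, h3⟩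
  · rintro (⟨he, k, h1, h2, h3⟩ | ⟨he, k, h1, h2, h3⟩)
    · exact ⟨he, k, h1, by push_cast; omega, h3⟩
    · exact ⟨he, k, by omega, by push_cast; omega, h3⟩

theorem seg_of_spoke {X : Set (PEdge n)} (hX : IsPM X) {i : ℤ} (h : S X i) :
    seg X i 1 = {spoke (i : ZMod n)} := by
  ext e
  simp only [seg, Set.mem_ofPred_eq, Set.mem_singleton_iff]
  constructor
  · rintro ⟨he, k, h1, h2, h3⟩
    obtain rfl : k = i := by push_cast at h2; omega
    have ho := hX.o k
    have hi := hX.i k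
    rcases h3 with rfl | rfl | rfl
    · change O X k at he
      grind [ExactlyOne]
    · rfl
    · change N X k at he
      grind [ExactlyOne]
  · rintro rfl
    exact ⟨h, i, le_rfl, by push_cast; omega, by tauto⟩

theorem seg_of_blk {X : Set (PEdge n)} (hX : IsPM X) {i : ℤ} (h : Blk X i) :
    seg X i 4 = aEdges (i : ZMod n) := by
  refine Set.Subset.antisymm ?_ fun e he => ⟨aEdges_subset_iff.2 h he, ?_⟩
  · rintro e ⟨he, k, h1, h2, h3⟩
    have ho := hX.o
    have hi := hX.i
    have hO : O X k → k = i ∨ k = i + 1 := by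
      intro hk
      obtain rfl | rfl | rfl | rfl : k = i ∨ k = i + 1 ∨ k = i + 2 ∨ k = i + 3 := by
        push_cast at h2; omega
      all_goals grind [ExactlyOne, Blk]
    have hN : N X k → k = i ∨ k = i + 2 := by
      intro hk
      obtain rfl | rfl | rfl | rfl : k = i ∨ k = i + 1 ∨ k = i + 2 ∨ k = i + 3 := by
        push_cast at h2; omega
      all_goals grind [ExactlyOne, Blk]
    have hS : ¬ S X k := by
      intro hk
      obtain rfl | rfl | rfl | rfl : k = i ∨ k = i + 1 ∨ k = i + 2 ∨ k = i + 3 := by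
        push_cast at h2; omega
      all_goals grind [ExactlyOne, Blk]
    rcases h3 with rfl | rfl | rfl
    · rcases hO he with rfl | rfl <;> simp [aEdges]
    · exact absurd he hS
    · rcases hN he with rfl | rfl <;> simp [aEdges]
  · simp only [aEdges, Set.mem_insert_iff, Set.mem_singleton_iff] at he
    rcases he with rfl | rfl | rfl | rfl
    · exact ⟨i, by omega, by push_cast; omega, by tauto⟩
    · exact ⟨i + 1, by omega, by push_cast; omega, by simp⟩
    · exact ⟨i, by omega, by push_cast; omega, by tauto⟩
    · exact ⟨i + 2, by omega, by push_cast; omega, by simp⟩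

theorem exists_abEdges_eq {X : Set (PEdge n)} (hX : IsPM X) (m : ℕ) :
    ∀ i : ℤ, Cut X i → Cut X (i + m) →
      ∃ L : List Bool, (L.map abLen).sum = m ∧ abEdges n (i : ZMod n) L = toSym2 '' seg X i m := by
  induction m using Nat.strong_induction_on with
  | _ m ih =>
    intro i hi him
    rcases Nat.eq_zero_or_pos m with rfl | hpos
    · refine ⟨[], rfl, ?_⟩
      have : seg X i 0 = ∅ := by
        ext e
        simp only [seg, Set.mem_ofPred_eq, Set.mem_empty_iff_false, iff_false]
        rintro ⟨-, k, h1, h2, -⟩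
        push_cast at h2
        omega
      rw [this, Set.image_empty]
      rfl
    rcases hX.cut_succ hi with ⟨hs, hc⟩ | hb
    · obtain ⟨m, rfl⟩ : ∃ m', m = 1 + m' := ⟨m - 1, by omega⟩
      obtain ⟨L, hL, hE⟩ := ih m (by omega) (i + 1) hc (by convert him using 1; push_cast; ring)
      refine ⟨false :: L, by simp [abLen, hL], ?_⟩
      rw [seg_add, Set.image_union, seg_of_spoke hX hs, image_spoke]
      push_cast at hE ⊢
      rw [← hE]
      rfl
    · have hm4 : 4 ≤ m := by
        by_contra hlt
        have := hX.o
        obtain rfl | rfl | rfl : m = 1 ∨ m = 2 ∨ m = 3 := by omega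
        all_goals
          push_cast at him
          grind [Blk, Cut]
      obtain ⟨m, rfl⟩ : ∃ m', m = 4 + m' := ⟨m - 4, by omega⟩
      obtain ⟨L, hL, hE⟩ := ih m (by omega) (i + 4) (hX.blk_cut hb).2
        (by convert him using 1; push_cast; ring)
      refine ⟨true :: L, by simp [abLen, hL], ?_⟩
      rw [seg_add, Set.image_union, seg_of_blk hX hb, image_aEdges]
      push_cast at hE ⊢
      rw [← hE]
      rfl

theorem seg_eq_self (hn : 5 ≤ n) (X : Set (PEdge n)) (i : ℤ) : seg X i n = X := by
  have : NeZero n := ⟨by omega⟩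
  refine Set.Subset.antisymm (fun e he => he.1) fun e he => ⟨he, ?_⟩
  have rep : ∀ j : ZMod n, ∃ k : ℤ, i ≤ k ∧ k < i + n ∧ (k : ZMod n) = j := by
    intro j
    have hlt := ZMod.val_lt (j - (i : ZMod n))
    exact ⟨i + (j - (i : ZMod n)).val, by omega, by omega, by simp⟩
  cases e with
  | outer j | spoke j | inner j =>
    obtain ⟨k, h1, h2, rfl⟩ := rep j
    exact ⟨k, h1, h2, by tauto⟩

theorem isType1_iff_hasCut (hn : 5 ≤ n) {M : (petersen n).Subgraph} (hM : IsPM (code M)) :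
    IsType1 M ↔ HasCut (code M) := by
  refine ⟨hasCut_of_isType1 hn hM, ?_⟩
  rintro ⟨i, hi⟩
  obtain ⟨L, hL, hE⟩ := exists_abEdges_eq hM n i hi (cut_add_natCast.2 hi)
  exact ⟨i, L, hL, by rw [hE, seg_eq_self hn, image_code (by omega)]⟩

end bridge

section small_cases

/-- A three-term alternative for the partner of an outer vertex. -/
theorem exists_adj_pu {n : ℕ} (hn : 3 ≤ n) {M : (petersen n).Subgraph}
    (hM : M.IsPerfectMatching) (i : ZMod n) :
    M.Adj (pu i) (pu (i + 2)) ∨ M.Adj (pu i) (pu (i - 2)) ∨ M.Adj (pu i) (pv i) := by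
  obtain ⟨w, hw, -⟩ := Subgraph.isPerfectMatching_iff.1 hM (pu i)
  rcases (adj_pu_iff hn M i w).1 hw with ⟨rfl, -⟩ | ⟨rfl, -⟩ | ⟨rfl, -⟩ <;> tauto

/-- A three-term alternative for the partner of an inner vertex. -/
theorem exists_adj_pv {n : ℕ} (hn : 3 ≤ n) {M : (petersen n).Subgraph}
    (hM : M.IsPerfectMatching) (i : ZMod n) :
    M.Adj (pv i) (pv (i + 1)) ∨ M.Adj (pv i) (pv (i - 1)) ∨ M.Adj (pv i) (pu i) := by
  obtain ⟨w, hw, -⟩ := Subgraph.isPerfectMatching_iff.1 hM (pv i)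
  rcases (adj_pv_iff hn M i w).1 hw with ⟨rfl, -⟩ | ⟨rfl, -⟩ | ⟨rfl, -⟩ <;> tauto

theorem edgeSet_subset_of_isType1_three {M M' : (petersen 3).Subgraph} (h : IsType1 M)
    (h' : IsType1 M') : M.edgeSet ⊆ M'.edgeSet := by
  have key : ∀ L : List Bool, (L.map abLen).sum = 3 → L = [false, false, false] := by
    intro L hL
    match L, hL with
    | [], hL | [false], hL | [false, false], hL => simp [abLen] at hL
    | [false, false, false], _ => rfl
    | true :: L, hL | false :: true :: L, hL | false :: false :: true :: L, hL
    | false :: false :: false :: true :: L, hL | false :: false :: false :: false :: L, hL =>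
      simp [abLen] at hL
      try omega
  obtain ⟨i, L, hL, hE⟩ := h
  obtain ⟨j, L', hL', hE'⟩ := h'
  obtain rfl := key L hL
  obtain rfl := key L' hL'
  rw [hE, hE']
  have hij : ∀ i j : ZMod 3, i = j ∨ i = j + 1 ∨ i = j + 1 + 1 := by decide
  intro e he
  simp only [abEdges, blockB, Set.mem_union, Set.mem_singleton_iff, Set.mem_empty_iff_false,
    or_false] at he ⊢
  rcases he with rfl | rfl | rfl
  · rcases hij i j with h | h | h <;> simp [h]
  · rcases hij (i + 1) j with h | h | h <;> simp [h]
  · rcases hij (i + 1 + 1) j with h | h | h <;> simp [h]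

theorem forcingNumber_le_one {V : Type*} {G : SimpleGraph V} {M : G.Subgraph}
    (hM : M.IsPerfectMatching) (e : Sym2 V) (he : e ∈ M.edgeSet)
    (h : ∀ M' : G.Subgraph, M'.IsPerfectMatching → e ∈ M'.edgeSet → M.edgeSet ⊆ M'.edgeSet) :
    forcingNumber G M ≤ 1 := by
  refine Nat.sInf_le ⟨{e}, ⟨by simpa using he, fun M' hM' heM' => ?_⟩, Set.ncard_singleton e⟩
  exact isPerfectMatching_eq_of_edgeSet_subset hM hM' (h M' hM' (heM' rfl))

theorem forcingNumber_le_one_of_isType1_four {M : (petersen 4).Subgraph}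
    (hM : M.IsPerfectMatching) (h : IsType1 M) : forcingNumber (petersen 4) M ≤ 1 := by
  have key : ∀ L : List Bool, (L.map abLen).sum = 4 →
      L = [false, false, false, false] ∨ L = [true] := by
    intro L hL
    match L, hL with
    | [], hL | [false], hL | [false, false], hL | [false, false, false], hL => simp [abLen] at hL
    | [false, false, false, false], _ => simp
    | [true], _ => simp
    | true :: true :: L, hL | true :: false :: L, hL
    | false :: true :: L, hL | false :: false :: true :: L, hL
    | false :: false :: false :: true :: L, hL | false :: false :: false :: false :: true :: L, hL
    | false :: false :: false :: false :: false :: L, hL =>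
      simp [abLen] at hL <;> omega
  obtain ⟨i, L, hL, hE⟩ := h
  have ids : ∀ i : ZMod 4, i - 2 = i + 2 ∧ i - 1 = i + 3 ∧ i + 1 + 2 = i + 3 ∧ i + 1 - 2 = i + 3 ∧
      i + 2 + 2 = i ∧ i + 2 - 2 = i ∧ i + 3 + 2 = i + 1 ∧ i + 3 - 2 = i + 1 ∧ i + 1 + 1 = i + 2 ∧
      i + 1 - 1 = i ∧ i + 2 + 1 = i + 3 ∧ i + 2 - 1 = i + 1 ∧ i + 3 + 1 = i ∧ i + 3 - 1 = i + 2 ∧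
      i ≠ i + 1 ∧ i ≠ i + 2 ∧ i ≠ i + 3 ∧ i + 1 ≠ i + 2 ∧ i + 1 ≠ i + 3 ∧ i + 2 ≠ i + 3 := by
    decide
  obtain ⟨a1, a2, a3, a4, a5, a6, a7, a8, a9, a10, a11, a12, a13, a14, d1, d2, d3, d4, d5, d6⟩ :=
    ids i
  have hne : ∀ a b : ZMod 4, (pu a : PV 4) ≠ pv b := fun a b h => by simp [pu, pv] at h
  have hu : ∀ a b : ZMod 4, pu a = pu b → a = b := fun a b h => Sum.inl_injective h
  have hv : ∀ a b : ZMod 4, pv a = pv b → a = b := fun a b h => Sum.inr_injective h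
  have facts : ∀ M' : (petersen 4).Subgraph, M'.IsPerfectMatching →
      (∀ a b c, M'.Adj a b → M'.Adj a c → b = c) ∧ (∀ a b, M'.Adj a b → M'.Adj b a) :=
    fun M' hM' => ⟨fun a b c => (Subgraph.isPerfectMatching_iff.1 hM' a).unique,
      fun a b => (M'.adj_comm a b).1⟩
  rcases key L hL with rfl | rfl
  · refine forcingNumber_le_one hM s(pu i, pv i) (by rw [hE]; exact Or.inl rfl) fun M' hM' he => ?_
    change M'.Adj (pu i) (pv i) at he
    obtain ⟨uniq, symm⟩ := facts M' hM'
    have u2 := exists_adj_pu (by norm_num) hM' (i + 2)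
    have v1 := exists_adj_pv (by norm_num) hM' (i + 1)
    have v3 := exists_adj_pv (by norm_num) hM' (i + 3)
    simp only [a5, a6, a9, a10, a13, a14, or_self_left] at u2 v1 v3
    have h2 : M'.Adj (pu (i + 2)) (pv (i + 2)) := by grind
    have h1 : M'.Adj (pu (i + 1)) (pv (i + 1)) := by grind
    have h3 : M'.Adj (pu (i + 3)) (pv (i + 3)) := by grind
    rw [hE]
    simp only [abEdges, blockB, a9, a11, Set.union_subset_iff, Set.singleton_subset_iff,
      Set.empty_subset, and_true]
    exact ⟨he, h1, h2, h3⟩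
  · refine forcingNumber_le_one hM s(pv i, pv (i + 1)) (by rw [hE]; exact Or.inl (by simp [blockA]))
      fun M' hM' he => ?_
    change M'.Adj (pv i) (pv (i + 1)) at he
    obtain ⟨uniq, symm⟩ := facts M' hM'
    have u0 := exists_adj_pu (by norm_num) hM' i
    have u1 := exists_adj_pu (by norm_num) hM' (i + 1)
    have v2 := exists_adj_pv (by norm_num) hM' (i + 2)
    simp only [a1, a3, a4, a11, a12, or_self_left] at u0 u1 v2
    have h0 : M'.Adj (pu i) (pu (i + 2)) := by grind
    have h1 : M'.Adj (pu (i + 1)) (pu (i + 3)) := by grind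
    have h2 : M'.Adj (pv (i + 2)) (pv (i + 3)) := by grind
    rw [hE]
    simp only [abEdges, blockA, Set.union_subset_iff, Set.insert_subset_iff,
      Set.singleton_subset_iff, Set.empty_subset, and_true]
    exact ⟨h0, h1, he, h2⟩

end small_cases

end PEdge

/-- for `n ≥ 3` the set of forcing numbers of type-1 perfect matchings
of `P(n,2)` is a set of consecutive integers. -/
theorem type1_spectrum_interval (n : ℕ) (hn : 3 ≤ n) :
    Set.OrdConnected {k | ∃ M : (petersen n).Subgraph,
      M.IsPerfectMatching ∧ IsType1 M ∧ forcingNumber (petersen n) M = k} := by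
  obtain rfl | rfl | hn5 : n = 3 ∨ n = 4 ∨ 5 ≤ n := by omega
  · refine ⟨?_⟩
    rintro _ ⟨M, hM, hM1, rfl⟩ _ ⟨M', hM', hM1', rfl⟩ k ⟨hk, hk'⟩
    rw [PEdge.isPerfectMatching_eq_of_edgeSet_subset hM hM'
      (PEdge.edgeSet_subset_of_isType1_three hM1 hM1')] at hk'
    exact ⟨M, hM, hM1, le_antisymm hk hk'⟩
  · refine ⟨?_⟩
    rintro _ ⟨M, hM, hM1, rfl⟩ _ ⟨M', hM', hM1', rfl⟩ k ⟨hk, hk'⟩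
    have := PEdge.forcingNumber_le_one_of_isType1_four hM' hM1'
    obtain h | h : forcingNumber (petersen 4) M = k ∨ forcingNumber (petersen 4) M' = k := by omega
    · exact ⟨M, hM, hM1, h⟩
    · exact ⟨M', hM', hM1', h⟩
  · convert PEdge.ordConnected_fnum hn5 using 1
    ext k
    constructor
    · rintro ⟨M, hM, hM1, rfl⟩
      have hX := (PEdge.isPerfectMatching_iff_isPM hn5 M).1 hM
      exact ⟨_, hX, (PEdge.isType1_iff_hasCut hn5 hX).1 hM1,
        (PEdge.forcingNumber_eq_fnum hn5 hM).symm⟩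
    · rintro ⟨X, hX, hXc, rfl⟩
      have hcode := PEdge.code_ofCode hn5 X
      have hM := (PEdge.isPerfectMatching_iff_isPM hn5 (PEdge.ofCode hn X)).2 (by rwa [hcode])
      exact ⟨PEdge.ofCode hn X, hM,
        (PEdge.isType1_iff_hasCut hn5 (by rwa [hcode])).2 (by rwa [hcode]),
        by rw [PEdge.forcingNumber_eq_fnum hn5 hM, hcode]⟩
end

section
/- Let n ≥ 5 and let M1 be a type-1 perfect matching of P(n,2) whose block decomposition contains at least one A and at least one B, with a block B at position i (the spoke u_i v_i) immediately followed by a block A at positions i+1, i+2, i+3, i+4 (so u_i v_i, u_{i+1} u_{i+3}, u_{i+2} u_{i+4}, v_{i+1} v_{i+2}, v_{i+3} v_{i+4} ∈ M1). Let M2 be the symmetric difference of M1 with the M1-alternating 8-cycle u_{i+1} u_{i+3} v_{i+3} v_{i+4} u_{i+4} u_{i+2} v_{i+2} v_{i+1} u_{i+1} (so M2 agrees with M1 outside these positions and contains the five spokes u_i v_i, u_{i+1} v_{i+1}, …, u_{i+4} v_{i+4}). Then |f(P(n,2),M1) − f(P(n,2),M2)| ≤ 1. -/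
open SimpleGraph

/-- The `M1`-alternating 8-cycle
`u_{i+1} u_{i+3} v_{i+3} v_{i+4} u_{i+4} u_{i+2} v_{i+2} v_{i+1} u_{i+1}`. -/
def cycBA (n : ℕ) (i : ZMod n) : Set (Sym2 (PV n)) :=
  {s(pu (i + 1), pu (i + 3)), s(pu (i + 3), pv (i + 3)), s(pv (i + 3), pv (i + 4)),
   s(pv (i + 4), pu (i + 4)), s(pu (i + 4), pu (i + 2)), s(pu (i + 2), pv (i + 2)),
   s(pv (i + 2), pv (i + 1)), s(pv (i + 1), pu (i + 1))}

section PerfectMatching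

variable {V : Type*} {G : SimpleGraph V} {M M' M₁ M₂ : G.Subgraph}

lemma eq_of_mem_edgeSet (hM : M.IsPerfectMatching) {x y z : V}
    (hy : s(x, y) ∈ M.edgeSet) (hz : s(x, z) ∈ M.edgeSet) : y = z :=
  (hM.1 (hM.2 x)).unique (Subgraph.mem_edgeSet.1 hy) (Subgraph.mem_edgeSet.1 hz)

lemma exists_mem_edgeSet (hM : M.IsPerfectMatching) (x : V) :
    ∃ y, G.Adj x y ∧ s(x, y) ∈ M.edgeSet := by
  obtain ⟨y, hy, -⟩ := hM.1 (hM.2 x)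
  exact ⟨y, hy.adj_sub, hy⟩

lemma eq_of_edgeSet_subset (hM : M.IsPerfectMatching) (hM' : M'.IsPerfectMatching)
    (h : M.edgeSet ⊆ M'.edgeSet) : M' = M := by
  refine Subgraph.ext ?_ ?_
  · ext x
    exact ⟨fun _ => hM.2 x, fun _ => hM'.2 x⟩
  · ext x y
    refine ⟨fun hxy => ?_, fun hxy => h (Subgraph.mem_edgeSet.2 hxy)⟩
    obtain ⟨z, -, hz⟩ := exists_mem_edgeSet hM x
    rwa [eq_of_mem_edgeSet hM' (Subgraph.mem_edgeSet.2 hxy) (h hz)]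

/-- If a perfect matching `M` contains `M₂ \ M₁`, then exchanging these edges for those of
`M₁ \ M₂` gives a perfect matching. -/
lemma exists_isPerfectMatching_exchange (h₁ : M₁.IsPerfectMatching) (h₂ : M₂.IsPerfectMatching)
    (hM : M.IsPerfectMatching) (h : M₂.edgeSet \ M₁.edgeSet ⊆ M.edgeSet) :
    ∃ N : G.Subgraph, N.IsPerfectMatching ∧
      N.edgeSet = (M.edgeSet \ (M₂.edgeSet \ M₁.edgeSet)) ∪ (M₁.edgeSet \ M₂.edgeSet) := by
  set E := (M.edgeSet \ (M₂.edgeSet \ M₁.edgeSet)) ∪ (M₁.edgeSet \ M₂.edgeSet) with hE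
  have hEG : E ⊆ G.edgeSet := by
    rintro e (he | he)
    · exact M.edgeSet_subset he.1
    · exact M₁.edgeSet_subset he.1
  let N : G.Subgraph :=
    { verts := Set.univ
      Adj := fun x y => s(x, y) ∈ E
      adj_sub := fun hxy => hEG hxy
      edge_vert := fun _ => Set.mem_univ _
      symm := ⟨fun x y hxy => by rwa [Sym2.eq_swap]⟩ }
  refine ⟨N, ⟨fun x _ => ?_, fun x => Set.mem_univ x⟩, ?_⟩
  · change ∃! y, s(x, y) ∈ E
    obtain ⟨a, -, ha⟩ := exists_mem_edgeSet h₁ x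
    obtain ⟨b, -, hb⟩ := exists_mem_edgeSet h₂ x
    obtain ⟨c, -, hc⟩ := exists_mem_edgeSet hM x
    by_cases hab : a = b
    · subst hab
      refine ⟨c, Or.inl ⟨hc, fun hc' => ?_⟩, ?_⟩
      · exact hc'.2 (eq_of_mem_edgeSet h₂ hb hc'.1 ▸ ha)
      · rintro y (hy | hy)
        · exact eq_of_mem_edgeSet hM hy.1 hc
        · exact absurd (eq_of_mem_edgeSet h₁ ha hy.1 ▸ hb) hy.2
    · have hb' : s(x, b) ∈ M₂.edgeSet \ M₁.edgeSet :=
        ⟨hb, fun hb' => hab (eq_of_mem_edgeSet h₁ ha hb')⟩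
      refine ⟨a, Or.inr ⟨ha, fun ha' => hab (eq_of_mem_edgeSet h₂ ha' hb)⟩, ?_⟩
      rintro y (hy | hy)
      · exact absurd (eq_of_mem_edgeSet hM (h hb') hy.1 ▸ hb') hy.2
      · exact eq_of_mem_edgeSet h₁ hy.1 ha
  · ext e
    induction e with
    | _ x y => exact Iff.rfl

lemma exists_isForcingSet_ncard_eq (hM : M.IsPerfectMatching) :
    ∃ S, IsForcingSet G M S ∧ S.ncard = forcingNumber G M :=
  Nat.sInf_mem (s := {k | ∃ S : Set (Sym2 V), IsForcingSet G M S ∧ S.ncard = k})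
    ⟨_, M.edgeSet, ⟨subset_rfl, fun _ hM' h => eq_of_edgeSet_subset hM hM' h⟩, rfl⟩

/-- If two edges of `M₂` suffice to force all edges of `M₂ \ M₁`, then the forcing number of
`M₂` exceeds that of `M₁` by at most one. -/
lemma forcingNumber_le_add_one [Finite V] (h₁ : M₁.IsPerfectMatching)
    (h₂ : M₂.IsPerfectMatching) {e f : Sym2 V} (he : e ∈ M₂.edgeSet) (hf : f ∈ M₂.edgeSet)
    (h : ∀ M : G.Subgraph, M.IsPerfectMatching → e ∈ M.edgeSet → f ∈ M.edgeSet →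
      M₂.edgeSet \ M₁.edgeSet ⊆ M.edgeSet) :
    forcingNumber G M₂ ≤ forcingNumber G M₁ + 1 := by
  obtain rfl | hne := eq_or_ne M₂ M₁
  · exact Nat.le_succ _
  obtain ⟨S, ⟨hSM, hS⟩, hcard⟩ := exists_isForcingSet_ncard_eq h₁
  obtain ⟨d, hdS, hd⟩ : ∃ d ∈ S, d ∉ M₂.edgeSet := by
    by_contra! hcon
    exact hne (hS M₂ h₂ hcon)
  have hforce : IsForcingSet G M₂ ((S ∩ M₂.edgeSet) ∪ {e, f}) := by
    refine ⟨?_, fun M hM hT => ?_⟩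
    · rintro x (hx | rfl | rfl)
      exacts [hx.2, he, hf]
    · have hsub := h M hM (hT (by simp)) (hT (by simp))
      obtain ⟨N, hN, hNE⟩ := exists_isPerfectMatching_exchange h₁ h₂ hM hsub
      have hNM : N = M₁ := by
        refine hS N hN fun x hx => ?_
        rw [hNE]
        by_cases hx₂ : x ∈ M₂.edgeSet
        · exact Or.inl ⟨hT (Or.inl ⟨hx, hx₂⟩), fun hx' => hx'.2 (hSM hx)⟩
        · exact Or.inr ⟨hSM hx, hx₂⟩
      subst hNM
      refine eq_of_edgeSet_subset h₂ hM fun x hx => ?_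
      by_cases hx₁ : x ∈ N.edgeSet
      · have hx' := hx₁
        rw [hNE] at hx'
        exact hx'.elim (fun hx' => hx'.1) (fun hx' => absurd hx hx'.2)
      · exact hsub ⟨hx, hx₁⟩
  have hle : forcingNumber G M₂ ≤ ((S ∩ M₂.edgeSet) ∪ {e, f}).ncard :=
    Nat.sInf_le ⟨_, hforce, rfl⟩
  have hlt : (S ∩ M₂.edgeSet).ncard < S.ncard :=
    Set.ncard_lt_ncard ⟨Set.inter_subset_left, fun hsub => hd (hsub hdS).2⟩ (Set.toFinite S)
  have hunion := Set.ncard_union_le (S ∩ M₂.edgeSet) {e, f}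
  have hpair := Set.ncard_insert_le e {f}
  rw [Set.ncard_singleton] at hpair
  omega

end PerfectMatching

section Petersen

variable {n : ℕ} {M : (petersen n).Subgraph}

lemma pu_ne_pv {i j : ZMod n} : (pu i : PV n) ≠ pv j := Sum.inl_ne_inr

lemma pv_ne_pu {i j : ZMod n} : (pv i : PV n) ≠ pu j := Sum.inr_ne_inl

lemma mem_edgeSet_pu (hM : M.IsPerfectMatching) {i j k : ZMod n} (hij : i + 2 = j)
    (hjk : j + 2 = k) :
    s(pu i, pu j) ∈ M.edgeSet ∨ s(pu j, pu k) ∈ M.edgeSet ∨ s(pu j, pv j) ∈ M.edgeSet := by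
  obtain ⟨y, hy, hyM⟩ := exists_mem_edgeSet hM (pu j)
  obtain ⟨-, hy⟩ := (SimpleGraph.fromRel_adj _ _ _).1 hy
  rcases hy with (⟨l, hl, rfl⟩ | ⟨l, hl, rfl⟩ | ⟨l, hl, rfl⟩) |
    (⟨l, rfl, hl⟩ | ⟨l, rfl, hl⟩ | ⟨l, rfl, hl⟩)
  · obtain rfl := Sum.inl_injective hl
    exact Or.inr (Or.inl (hjk ▸ hyM))
  · obtain rfl := Sum.inl_injective hl
    exact Or.inr (Or.inr hyM)
  · exact absurd hl pu_ne_pv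
  · obtain rfl := add_right_cancel (hij.trans (Sum.inl_injective hl))
    exact Or.inl (Sym2.eq_swap ▸ hyM)
  · exact absurd hl pu_ne_pv
  · exact absurd hl pu_ne_pv

lemma mem_edgeSet_pv (hM : M.IsPerfectMatching) {i j k : ZMod n} (hij : i + 1 = j)
    (hjk : j + 1 = k) :
    s(pv i, pv j) ∈ M.edgeSet ∨ s(pv j, pv k) ∈ M.edgeSet ∨ s(pu j, pv j) ∈ M.edgeSet := by
  obtain ⟨y, hy, hyM⟩ := exists_mem_edgeSet hM (pv j)
  obtain ⟨-, hy⟩ := (SimpleGraph.fromRel_adj _ _ _).1 hy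
  rcases hy with (⟨l, hl, rfl⟩ | ⟨l, hl, rfl⟩ | ⟨l, hl, rfl⟩) |
    (⟨l, rfl, hl⟩ | ⟨l, rfl, hl⟩ | ⟨l, rfl, hl⟩)
  · exact absurd hl pv_ne_pu
  · exact absurd hl pv_ne_pu
  · obtain rfl := Sum.inr_injective hl
    exact Or.inr (Or.inl (hjk ▸ hyM))
  · exact absurd hl pv_ne_pu
  · obtain rfl := Sum.inr_injective hl
    exact Or.inr (Or.inr (Sym2.eq_swap ▸ hyM))
  · obtain rfl := add_right_cancel (hij.trans (Sum.inr_injective hl))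
    exact Or.inl (Sym2.eq_swap ▸ hyM)

lemma spoke_notMem_of_pu (hM : M.IsPerfectMatching) {i j : ZMod n}
    (h : s(pu i, pu j) ∈ M.edgeSet) :
    s(pu i, pv i) ∉ M.edgeSet ∧ s(pu j, pv j) ∉ M.edgeSet :=
  ⟨fun h' => pu_ne_pv (eq_of_mem_edgeSet hM h h'),
    fun h' => pu_ne_pv (eq_of_mem_edgeSet hM (Sym2.eq_swap ▸ h) h')⟩

lemma spoke_notMem_of_pv (hM : M.IsPerfectMatching) {i j : ZMod n}
    (h : s(pv i, pv j) ∈ M.edgeSet) :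
    s(pu i, pv i) ∉ M.edgeSet ∧ s(pu j, pv j) ∉ M.edgeSet :=
  ⟨fun h' => pv_ne_pu (eq_of_mem_edgeSet hM h (Sym2.eq_swap ▸ h')),
    fun h' => pv_ne_pu (eq_of_mem_edgeSet hM (Sym2.eq_swap ▸ h) (Sym2.eq_swap ▸ h'))⟩

/-- The spokes at positions `i` and `i + 4` force the spokes in between. -/
lemma spokes_mem_of_spokes_mem (hM : M.IsPerfectMatching) {i : ZMod n}
    (h0 : s(pu i, pv i) ∈ M.edgeSet) (h4 : s(pu (i + 4), pv (i + 4)) ∈ M.edgeSet) :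
    s(pu (i + 1), pv (i + 1)) ∈ M.edgeSet ∧ s(pu (i + 2), pv (i + 2)) ∈ M.edgeSet ∧
      s(pu (i + 3), pv (i + 3)) ∈ M.edgeSet := by
  have h2 : s(pu (i + 2), pv (i + 2)) ∈ M.edgeSet := by
    rcases mem_edgeSet_pu hM (i := i) (j := i + 2) (k := i + 4) rfl (by ring) with h | h | h
    · exact absurd h0 (spoke_notMem_of_pu hM h).1
    · exact absurd h4 (spoke_notMem_of_pu hM h).2
    · exact h
  refine ⟨?_, h2, ?_⟩
  · rcases mem_edgeSet_pv hM (i := i) (j := i + 1) (k := i + 2) rfl (by ring) with h | h | h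
    · exact absurd h0 (spoke_notMem_of_pv hM h).1
    · exact absurd h2 (spoke_notMem_of_pv hM h).2
    · exact h
  · rcases mem_edgeSet_pv hM (i := i + 2) (j := i + 3) (k := i + 4) (by ring) (by ring)
      with h | h | h
    · exact absurd h2 (spoke_notMem_of_pv hM h).1
    · exact absurd h4 (spoke_notMem_of_pv hM h).2
    · exact h

/-- The spoke at position `i` and the edge `u_{i+1} u_{i+3}` force a block `A` at position
`i + 1`. -/
lemma blockA_mem_of_spoke_mem (hM : M.IsPerfectMatching) {i : ZMod n}
    (h0 : s(pu i, pv i) ∈ M.edgeSet) (h13 : s(pu (i + 1), pu (i + 3)) ∈ M.edgeSet) :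
    s(pv (i + 1), pv (i + 2)) ∈ M.edgeSet ∧ s(pv (i + 3), pv (i + 4)) ∈ M.edgeSet ∧
      s(pu (i + 2), pu (i + 4)) ∈ M.edgeSet := by
  have h12 : s(pv (i + 1), pv (i + 2)) ∈ M.edgeSet := by
    rcases mem_edgeSet_pv hM (i := i) (j := i + 1) (k := i + 2) rfl (by ring) with h | h | h
    · exact absurd h0 (spoke_notMem_of_pv hM h).1
    · exact h
    · exact absurd h (spoke_notMem_of_pu hM h13).1
  refine ⟨h12, ?_, ?_⟩
  · rcases mem_edgeSet_pv hM (i := i + 2) (j := i + 3) (k := i + 4) (by ring) (by ring)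
      with h | h | h
    · have heq := Sum.inr_injective (eq_of_mem_edgeSet hM (Sym2.eq_swap ▸ h12) h)
      have hne : (pu (i + 1) : PV n) ≠ pu (i + 3) :=
        (Subgraph.mem_edgeSet.1 h13).adj_sub.ne
      exact absurd (congrArg pu heq) hne
    · exact h
    · exact absurd h (spoke_notMem_of_pu hM h13).2
  · rcases mem_edgeSet_pu hM (i := i) (j := i + 2) (k := i + 4) rfl (by ring) with h | h | h
    · exact absurd h0 (spoke_notMem_of_pu hM h).1
    · exact h
    · exact absurd h (spoke_notMem_of_pv hM h12).2

end Petersen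

/-- transforming a chain `BA` into `B^5` changes the forcing number by at
most one. `M1` is a type-1 perfect matching with a block `B` at position `i` immediately
followed by a block `A` at positions `i+1,…,i+4`; `M2` is the symmetric difference of `M1`
with the alternating 8-cycle `cycBA n i`. -/
theorem BA_transform_forcing (n : ℕ) (hn : 5 ≤ n) (i : ZMod n)
    (M1 M2 : (petersen n).Subgraph)
    (hM1 : M1.IsPerfectMatching) (hT1 : IsType1 M1)
    (hB : s(pu i, pv i) ∈ M1.edgeSet)
    (hA1 : s(pu (i + 1), pu (i + 3)) ∈ M1.edgeSet)
    (hA2 : s(pu (i + 2), pu (i + 4)) ∈ M1.edgeSet)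
    (hA3 : s(pv (i + 1), pv (i + 2)) ∈ M1.edgeSet)
    (hA4 : s(pv (i + 3), pv (i + 4)) ∈ M1.edgeSet)
    (hM2 : M2.IsPerfectMatching)
    (hE2 : M2.edgeSet = symmDiff M1.edgeSet (cycBA n i)) :
    |(forcingNumber (petersen n) M1 : ℤ) - (forcingNumber (petersen n) M2 : ℤ)| ≤ 1 := by
  have : NeZero n := ⟨by omega⟩
  obtain ⟨n1, n3⟩ := spoke_notMem_of_pu hM1 hA1
  obtain ⟨n2, n4⟩ := spoke_notMem_of_pu hM1 hA2
  have hcyc : ∀ x ∈ cycBA n i, x ∈ M1.edgeSet →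
      x = s(pu (i + 1), pu (i + 3)) ∨ x = s(pu (i + 2), pu (i + 4)) ∨
      x = s(pv (i + 1), pv (i + 2)) ∨ x = s(pv (i + 3), pv (i + 4)) := by
    rintro x (rfl | rfl | rfl | rfl | rfl | rfl | rfl | rfl) hx
    · exact Or.inl rfl
    · exact absurd hx n3
    · exact Or.inr (Or.inr (Or.inr rfl))
    · exact absurd (Sym2.eq_swap ▸ hx) n4
    · exact Or.inr (Or.inl Sym2.eq_swap)
    · exact absurd hx n2
    · exact Or.inr (Or.inr (Or.inl Sym2.eq_swap))
    · exact absurd (Sym2.eq_swap ▸ hx) n1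
  have hB2 : s(pu i, pv i) ∈ M2.edgeSet := by
    rw [hE2]
    refine Or.inl ⟨hB, fun hc => ?_⟩
    rcases hcyc _ hc hB with h | h | h | h <;> simp [pu, pv] at h
  have h42 : s(pu (i + 4), pv (i + 4)) ∈ M2.edgeSet := by
    rw [hE2]
    exact Or.inr ⟨by simp [cycBA, Sym2.eq_swap], n4⟩
  have h21 : forcingNumber (petersen n) M2 ≤ forcingNumber (petersen n) M1 + 1 := by
    refine forcingNumber_le_add_one hM1 hM2 hB2 h42 fun M hM h0 h4 => ?_
    obtain ⟨h1, h2, h3⟩ := spokes_mem_of_spokes_mem hM h0 h4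
    rintro x ⟨hx2, hx1⟩
    rw [hE2] at hx2
    obtain ⟨hx, -⟩ := hx2.resolve_left fun h => hx1 h.1
    rcases hx with rfl | rfl | rfl | rfl | rfl | rfl | rfl | rfl
    · exact absurd hA1 hx1
    · exact h3
    · exact absurd hA4 hx1
    · exact Sym2.eq_swap ▸ h4
    · exact absurd (Sym2.eq_swap ▸ hA2) hx1
    · exact h2
    · exact absurd (Sym2.eq_swap ▸ hA3) hx1
    · exact Sym2.eq_swap ▸ h1
  have h12 : forcingNumber (petersen n) M1 ≤ forcingNumber (petersen n) M2 + 1 := by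
    refine forcingNumber_le_add_one hM2 hM1 hB hA1 fun M hM h0 h13 => ?_
    obtain ⟨hv12, hv34, hu24⟩ := blockA_mem_of_spoke_mem hM h0 h13
    rintro x ⟨hx1, hx2⟩
    have hx : x ∈ cycBA n i := by
      by_contra hc
      exact hx2 (hE2 ▸ Or.inl ⟨hx1, hc⟩)
    rcases hcyc x hx hx1 with rfl | rfl | rfl | rfl
    exacts [h13, hu24, hv12, hv34]
  rw [abs_le]
  constructor <;> omega
end

section
/- For n ≥ 34, the maximum of f(P(n,2),M) over all type-2 perfect matchings M of P(n,2) equals ⌈(n+3)/7⌉ + δ(n), where δ(n) = 1 if n ≡ 3 (mod 7) and δ(n) = 0 otherwise. -/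
open SimpleGraph

namespace PetersenForcing

/-- The edges `u_i u_{i+2}`, `u_i v_i`, `v_i v_{i+1}` of a matching at a position `i`. -/
abbrev Cell := Bool × Bool × Bool

/-- The edges `u_{i-2} u_i`, `u_{i-1} u_{i+1}`, `v_{i-1} v_i` of a matching that cross the cut
just before position `i`. -/
abbrev Cut := Bool × Bool × Bool

def Cell.sub (p y : Cell) : Bool := (!p.1 || y.1) && (!p.2.1 || y.2.1) && (!p.2.2 || y.2.2)

def Cell.weight (p : Cell) : ℕ := p.1.toNat + p.2.1.toNat + p.2.2.toNat

def exactlyOne (a b c : Bool) : Bool := (a && !b && !c) || (!a && b && !c) || (!a && !b && c)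

/-- A cell is compatible with a cut if both vertices at its position are covered once. -/
def ok (s : Cut) (y : Cell) : Bool :=
  exactlyOne s.1 y.2.1 y.1 && exactlyOne s.2.2 y.2.1 y.2.2

/-- The cut after a cell. -/
def nxt (s : Cut) (y : Cell) : Cut := (s.2.1, y.1, y.2.2)

def Path : Cut → List Cell → Cut → Prop
  | s, [], t => s = t
  | s, y :: x, t => ok s y ∧ Path (nxt s y) x t

/-- The cut of a type-2 matching between two blocks. -/
def s₀ : Cut := (false, false, true)

abbrev Sub (ps x : List Cell) : Prop := List.Forall₂ (fun p y => Cell.sub p y) ps x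

def totalWeight (ps : List Cell) : ℕ := (ps.map Cell.weight).sum

/-- Some path from `s` to `t` contains the pins `ps` and is not the path `w` from `s₀`. -/
def Alt (w ps : List Cell) (s t : Cut) : Prop :=
  ∃ x, Path s x t ∧ Sub ps x ∧ (s = s₀ → x ≠ w)

theorem path_append {s t : Cut} {x x' : List Cell} :
    Path s (x ++ x') t ↔ ∃ u, Path s x u ∧ Path u x' t := by
  induction x generalizing s with
  | nil => simp [Path]
  | cons y x ih => simp [Path, ih, and_assoc]

theorem path_snoc {s t : Cut} {x : List Cell} {y : Cell} :
    Path s (x ++ [y]) t ↔ ∃ u, Path s x u ∧ ok u y ∧ nxt u y = t := by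
  simp [path_append, Path]

theorem Path.end_unique {s t t' : Cut} {x : List Cell} (h : Path s x t) (h' : Path s x t') :
    t = t' := by
  induction x generalizing s with
  | nil => exact h.symm.trans h'
  | cons y x ih => exact ih h.2 h'.2

theorem sub_snoc {ps : List Cell} {p : Cell} {x : List Cell} :
    Sub (ps ++ [p]) x ↔ ∃ x' z, x = x' ++ [z] ∧ Sub ps x' ∧ Cell.sub p z := by
  rw [Sub, ← List.forall₂_reverse_iff]
  simp only [List.reverse_append, List.reverse_cons, List.reverse_nil, List.nil_append,
    List.cons_append, List.forall₂_cons_left_iff]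
  constructor
  · rintro ⟨z, u, hz, hu, hx⟩
    refine ⟨u.reverse, z, ?_, ?_, hz⟩
    · rw [← List.reverse_reverse x, hx]; simp
    · rw [Sub, ← List.forall₂_reverse_iff]; simpa using hu
  · rintro ⟨x', z, rfl, hx', hz⟩
    exact ⟨z, x'.reverse, hz, List.forall₂_reverse_iff.2 hx', by simp⟩

theorem alt_snoc {w ps : List Cell} {y p : Cell} {m s t : Cut} (hm : Path s₀ w m)
    (hps : Sub ps w) :
    Alt (w ++ [y]) (ps ++ [p]) s t ↔ ∃ u z, (ok u z ∧ nxt u z = t ∧ Cell.sub p z) ∧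
      (Alt w ps s u ∨ (s = s₀ ∧ u = m ∧ z ≠ y)) := by
  constructor
  · rintro ⟨x, hx, hs, hne⟩
    obtain ⟨x', z, rfl, hx', hz⟩ := sub_snoc.1 hs
    obtain ⟨u, hu, hok, hn⟩ := path_snoc.1 hx
    refine ⟨u, z, ⟨hok, hn, hz⟩, ?_⟩
    by_cases h : s = s₀ ∧ x' = w
    · obtain ⟨rfl, rfl⟩ := h
      refine Or.inr ⟨rfl, hu.end_unique hm, ?_⟩
      rintro rfl
      exact hne rfl rfl
    · exact Or.inl ⟨x', hu, hx', fun hs' hw => h ⟨hs', hw⟩⟩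
  · rintro ⟨u, z, ⟨hok, hn, hz⟩, ⟨x, hx, hs, hne⟩ | ⟨rfl, rfl, hzy⟩⟩
    · refine ⟨x ++ [z], path_snoc.2 ⟨u, hx, hok, hn⟩, sub_snoc.2 ⟨x, z, rfl, hs, hz⟩, ?_⟩
      intro hs' h
      exact hne hs' (List.append_inj_left' h rfl)
    · refine ⟨w ++ [z], path_snoc.2 ⟨u, hm, hok, hn⟩, sub_snoc.2 ⟨w, z, rfl, hps, hz⟩, ?_⟩
      intro _ h
      simpa [hzy] using List.append_inj_right' h rfl

/-! ### Bit masks of pairs of cuts -/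

def idx (s : Cut) : ℕ := 4 * s.1.toNat + 2 * s.2.1.toNat + s.2.2.toNat

def pairIdx (s t : Cut) : ℕ := 8 * idx s + idx t

theorem idx_lt (s : Cut) : idx s < 8 := by revert s; decide

theorem idx_inj {s t : Cut} : idx s = idx t ↔ s = t := by revert s t; decide

def moves : List (Cut × Cell) :=
  [((false, false, false), (true, false, true)), ((false, false, true), (true, false, false)),
   ((false, true, false), (true, false, true)), ((false, true, true), (true, false, false)),
   ((true, false, false), (false, false, true)), ((true, false, true), (false, false, false)),
   ((true, true, false), (false, false, true)), ((true, true, true), (false, false, false)),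
   ((false, false, false), (false, true, false)), ((false, true, false), (false, true, false))]

theorem mem_moves {e : Cut × Cell} : e ∈ moves ↔ ok e.1 e.2 := by revert e; decide

/-- Row-wise column shift of an `8 × 8` bit matrix: column `i` is moved to column `j`. -/
def moveColumn (X i j : ℕ) : ℕ := ((X >>> i) &&& 0x0101010101010101) <<< j

def stepMask (m : Cut) (y p : Cell) (X : ℕ) : ℕ :=
  moves.foldl (fun Z e => Z |||
    if Cell.sub p e.2 then
      moveColumn X (idx e.1) (idx (nxt e.1 e.2)) |||
        if idx e.1 == idx m && e.2 != y then 1 <<< (8 + idx (nxt e.1 e.2)) else 0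
    else 0) 0

theorem testBit_foldl_or {α : Type*} (g : α → ℕ) (l : List α) (Z k : ℕ) :
    (l.foldl (fun Z e => Z ||| g e) Z).testBit k = true ↔
      Z.testBit k = true ∨ ∃ e ∈ l, (g e).testBit k = true := by
  induction l generalizing Z with
  | nil => simp
  | cons e l ih => simp [ih, or_assoc]

theorem testBit_moveColumn {X : ℕ} {i j : ℕ} {s t : Cut} (hj : j < 8) :
    (moveColumn X i j).testBit (pairIdx s t) = true ↔
      j = idx t ∧ X.testBit (8 * idx s + i) = true := by
  have hs := idx_lt s
  have ht := idx_lt t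
  have key : ∀ a < 64, (0x0101010101010101 : ℕ).testBit a = true ↔ a % 8 = 0 := by decide
  unfold moveColumn pairIdx
  rw [Nat.testBit_shiftLeft, Nat.testBit_and, Nat.testBit_shiftRight]
  simp only [Bool.and_eq_true, decide_eq_true_eq]
  constructor
  · rintro ⟨h1, h2, h3⟩
    rw [key _ (by omega)] at h3
    have hjt : j = idx t := by omega
    refine ⟨hjt, ?_⟩
    rwa [show 8 * idx s + i = i + (8 * idx s + idx t - j) by omega]
  · rintro ⟨rfl, h⟩
    refine ⟨by omega, ?_, (key _ (by omega)).2 (by omega)⟩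
    rwa [show i + (8 * idx s + idx t - idx t) = 8 * idx s + i by omega]

theorem testBit_stepMask {m : Cut} {y p : Cell} {X : ℕ} {s t : Cut} :
    (stepMask m y p X).testBit (pairIdx s t) = true ↔
      ∃ u z, (ok u z ∧ nxt u z = t ∧ Cell.sub p z) ∧
        (X.testBit (pairIdx s u) = true ∨ (s = s₀ ∧ u = m ∧ z ≠ y)) := by
  have hbranch : ∀ v : Cut, (1 <<< (8 + idx v)).testBit (pairIdx s t) = true ↔
      s = s₀ ∧ v = t := by
    intro v
    have hs := idx_lt s
    have ht := idx_lt t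
    have hv := idx_lt v
    have h0 : idx s₀ = 1 := by decide
    rw [Nat.one_shiftLeft, Nat.testBit_two_pow, decide_eq_true_eq, ← idx_inj, ← idx_inj, h0,
      pairIdx]
    omega
  unfold stepMask
  rw [testBit_foldl_or]
  simp only [Nat.zero_testBit, Bool.false_eq_true, false_or]
  constructor
  · rintro ⟨⟨u, z⟩, hmem, hb⟩
    have hok := mem_moves.1 hmem
    simp only at hok hb
    split_ifs at hb with hp hc
    · rw [Nat.testBit_or, Bool.or_eq_true, testBit_moveColumn (idx_lt _), hbranch] at hb
      simp only [Bool.and_eq_true, beq_iff_eq, bne_iff_ne, idx_inj] at hc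
      rcases hb with ⟨h1, h2⟩ | ⟨h1, h2⟩
      · exact ⟨u, z, ⟨hok, idx_inj.1 h1, hp⟩, Or.inl h2⟩
      · exact ⟨u, z, ⟨hok, h2, hp⟩, Or.inr ⟨h1, hc⟩⟩
    · rw [Nat.or_zero, testBit_moveColumn (idx_lt _)] at hb
      exact ⟨u, z, ⟨hok, idx_inj.1 hb.1, hp⟩, Or.inl hb.2⟩
    · simp at hb
  · rintro ⟨u, z, ⟨hok, hn, hp⟩, h⟩
    refine ⟨(u, z), mem_moves.2 hok, ?_⟩
    simp only [hp, if_true]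
    rw [Nat.testBit_or, Bool.or_eq_true, testBit_moveColumn (idx_lt _)]
    rcases h with h | ⟨h1, rfl, h2⟩
    · exact Or.inl ⟨by rw [hn], h⟩
    · right
      rw [if_pos (by simpa using h2), hbranch]
      exact ⟨h1, hn⟩

/-! ### Cells of a word in the blocks `C` and `D` -/

/-- The cells of a block `C` (`true`) or `D` (`false`). -/
def cells : Bool → List Cell
  | true => [(true, false, false), (false, true, false), (false, false, true)]
  | false =>
    [(true, false, false), (true, false, true), (false, false, false), (false, false, true)]

def wordCells (L : List Bool) : List Cell := L.flatMap cells

theorem wordCells_append (L L' : List Bool) :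
    wordCells (L ++ L') = wordCells L ++ wordCells L' := List.flatMap_append

theorem wordCells_cons (b : Bool) (L : List Bool) :
    wordCells (b :: L) = cells b ++ wordCells L := List.flatMap_cons

theorem length_cells (b : Bool) : (cells b).length = cdLen b := by cases b <;> rfl

theorem length_wordCells (L : List Bool) : (wordCells L).length = (L.map cdLen).sum := by
  induction L with
  | nil => rfl
  | cons b L ih => simp [wordCells_cons, length_cells, ih]

theorem path_cells (b : Bool) : Path s₀ (cells b) s₀ := by
  cases b <;> simp [cells, Path, s₀, ok, nxt, exactlyOne]

theorem path_wordCells (L : List Bool) : Path s₀ (wordCells L) s₀ := by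
  induction L with
  | nil => rfl
  | cons b L ih => rw [wordCells_cons]; exact path_append.2 ⟨_, path_cells b, ih⟩

theorem sub_append {ps qs x y : List Cell} (h : Sub ps x) (h' : Sub qs y) :
    Sub (ps ++ qs) (x ++ y) := List.rel_append h h'

/-! ### Upper bound -/

def Over (w ps : List Cell) (X : ℕ) : Prop :=
  ∀ t, Alt w ps s₀ t → X.testBit (pairIdx s₀ t) = true

def runMask : Cut → ℕ → List Cell → List Cell → ℕ
  | m, X, y :: ys, q :: qs => runMask (nxt m y) (stepMask m y q X) ys qs
  | _, X, _, _ => X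

theorem Over.run {w ps ys qs : List Cell} {X : ℕ} {m m' : Cut} (hX : Over w ps X)
    (hm : Path s₀ w m) (hps : Sub ps w) (hm' : Path m ys m') (hqs : Sub qs ys) :
    Over (w ++ ys) (ps ++ qs) (runMask m X ys qs) := by
  induction ys generalizing w ps qs X m with
  | nil =>
    cases hqs
    simpa [runMask] using hX
  | cons y ys ih =>
    cases hqs with
    | @cons q _ qs _ hq hqs =>
      have hw : Path s₀ (w ++ [y]) (nxt m y) := path_snoc.2 ⟨m, hm, hm'.1, rfl⟩
      have hov : Over (w ++ [y]) (ps ++ [q]) (stepMask m y q X) := by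
        intro t ht
        rw [testBit_stepMask]
        obtain ⟨u, z, h, h'⟩ := (alt_snoc hm hps).1 ht
        exact ⟨u, z, h, h'.imp_left (hX u)⟩
      simpa [runMask] using ih hov hw (sub_append hps (.cons hq .nil)) hm'.2 hqs

theorem Over.mono {w ps : List Cell} {X Y : ℕ} (hX : Over w ps X) (h : X &&& Y = X) :
    Over w ps Y := by
  intro t ht
  have := hX t ht
  rw [← h, Nat.testBit_and, Bool.and_eq_true] at this
  exact this.2

/-- The pins `ps` determine the path `w` among all paths from `s₀` to `s₀`. -/
def Forces (w ps : List Cell) : Prop := ∀ x, Path s₀ x s₀ → Sub ps x → x = w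

theorem Over.forces {w ps : List Cell} {X : ℕ} (hX : Over w ps X)
    (h : X.testBit (pairIdx s₀ s₀) = false) : Forces w ps := by
  intro x hx hs
  by_contra hne
  simpa [h] using hX s₀ ⟨x, hx, hs, fun _ => hne⟩

/-- The word `L` has pins of total weight `c` such that the alternatives are among those in `X`,
where `7 * c + v` is the length of `L`, up to some unused weight. -/
def Achieves (L : List Bool) (e : ℕ × ℕ) : Prop :=
  ∃ ps, Sub ps (wordCells L) ∧ Over (wordCells L) ps e.1 ∧
    ∃ j, (L.map cdLen).sum = 7 * (totalWeight ps + j) + e.2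

def pinChoices : Bool → List (List Cell)
  | true =>
    [[(false, false, false), (false, false, false), (false, false, false)],
     [(true, false, false), (false, false, false), (false, false, false)],
     [(false, false, false), (false, true, false), (false, false, false)],
     [(false, false, false), (false, false, false), (false, false, true)]]
  | false =>
    [[(false, false, false), (false, false, false), (false, false, false), (false, false, false)],
     [(true, false, false), (false, false, false), (false, false, false), (false, false, false)],
     [(false, false, false), (true, false, false), (false, false, false), (false, false, false)],
     [(false, false, false), (false, false, true), (false, false, false), (false, false, false)],
     [(false, false, false), (false, false, false), (false, false, false), (false, false, true)]]

theorem sub_of_mem_pinChoices {b : Bool} {q : List Cell} (hq : q ∈ pinChoices b) :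
    Sub q (cells b) := by
  revert q
  cases b <;> simp [pinChoices, cells, Cell.sub]

/-- Slacks above `8` are lowered by `7`. -/
def capSlack (v : ℕ) : ℕ := if v ≤ 8 then v else v - 7

def extend (b : Bool) (e : ℕ × ℕ) : List (ℕ × ℕ) :=
  ((pinChoices b).filter fun q => 7 * totalWeight q ≤ e.2 + cdLen b).map fun q =>
    (runMask s₀ e.1 (cells b) q, capSlack (e.2 + cdLen b - 7 * totalWeight q))

theorem totalWeight_append (ps qs : List Cell) :
    totalWeight (ps ++ qs) = totalWeight ps + totalWeight qs := by simp [totalWeight]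

theorem Achieves.extend {L : List Bool} {b : Bool} {e e' : ℕ × ℕ} (h : Achieves L e)
    (he' : e' ∈ extend b e) : Achieves (L ++ [b]) e' := by
  obtain ⟨ps, hps, hov, j, hj⟩ := h
  simp only [PetersenForcing.extend, List.mem_map, List.mem_filter, decide_eq_true_eq] at he'
  obtain ⟨q, ⟨hq, hle⟩, rfl⟩ := he'
  have hsub := sub_of_mem_pinChoices hq
  have hcells : wordCells (L ++ [b]) = wordCells L ++ cells b := by
    simp [wordCells]
  refine ⟨ps ++ q, ?_, ?_, ?_⟩
  · rw [hcells]; exact sub_append hps hsub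
  · rw [hcells]; exact hov.run (path_wordCells L) hps (path_cells b) hsub
  · simp only [capSlack, List.map_append, List.map_cons, List.map_nil, List.sum_append,
      List.sum_singleton, totalWeight_append]
    split_ifs with h8
    · exact ⟨j, by omega⟩
    · exact ⟨j + 1, by omega⟩

/-- `e` is at least as good as `e'`: fewer alternatives and no less slack. -/
def better (e e' : ℕ × ℕ) : Bool := e.1 &&& e'.1 == e.1 && e'.2 ≤ e.2 && (e.2 - e'.2) % 7 == 0

theorem Achieves.of_better {L : List Bool} {e e' : ℕ × ℕ} (h : Achieves L e)
    (hb : better e e' = true) : Achieves L e' := by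
  obtain ⟨ps, hps, hov, j, hj⟩ := h
  simp only [better, Bool.and_eq_true, beq_iff_eq, decide_eq_true_eq] at hb
  exact ⟨ps, hps, hov.mono hb.1.1, j + (e.2 - e'.2) / 7, by omega⟩

abbrev Front := List (ℕ × ℕ)

def insertBest (e : ℕ × ℕ) (F : Front) : Front :=
  if F.any (better · e) then F else e :: F.filter fun e' => !better e e'

def extendFront (b : Bool) (F : Front) : Front := (F.flatMap (extend b)).foldr insertBest []

def Front.dominates (F F' : Front) : Bool := F'.all fun e' => F.any (better · e')

theorem mem_of_mem_foldr_insertBest {e : ℕ × ℕ} {l : Front}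
    (h : e ∈ l.foldr insertBest []) : e ∈ l := by
  induction l with
  | nil => exact h
  | cons a l ih =>
    rw [List.foldr_cons, insertBest] at h
    split_ifs at h with h'
    · exact List.mem_cons_of_mem _ (ih h)
    · rcases List.mem_cons.1 h with rfl | h
      · exact List.mem_cons_self
      · exact List.mem_cons_of_mem _ (ih (List.mem_filter.1 h).1)

/-- Closure of `todo` under `extendFront`, up to domination. -/
def explore : ℕ → List Front → List Front → List Front
  | 0, done, todo => done ++ todo
  | _ + 1, done, [] => done
  | k + 1, done, F :: todo =>
    explore k (F :: done) <| [true, false].foldl (fun l b =>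
      let F' := extendFront b F
      if (F :: done ++ l).any F'.dominates then l else l ++ [F']) todo

def fronts : List Front := explore 60 [] [[(0, 0)]]

def frontsClosed : Bool :=
  fronts.any (fun F => F == [(0, 0)]) &&
  fronts.all fun F =>
    [true, false].all (fun b => let F' := extendFront b F; fronts.any F'.dominates) &&
    F.any fun e => e.1.testBit 9 == false && e.2 != 1

theorem frontsClosed_eq_true : frontsClosed = true := by decide +kernel

theorem exists_front (L : List Bool) : ∃ F ∈ fronts, ∀ e ∈ F, Achieves L e := by
  have hc := frontsClosed_eq_true
  simp only [frontsClosed, Bool.and_eq_true, List.any_eq_true, List.all_eq_true] at hc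
  induction L using List.reverseRecOn with
  | nil =>
    obtain ⟨F, hF, h⟩ := hc.1
    rw [beq_iff_eq] at h
    subst h
    refine ⟨_, hF, fun e he => ?_⟩
    rw [List.mem_singleton] at he
    subst he
    refine ⟨[], .nil, ?_, 0, by simp [totalWeight]⟩
    rintro t ⟨x, -, hs, hne⟩
    cases hs
    exact (hne rfl rfl).elim
  | append_singleton L b ih =>
    obtain ⟨F, hF, h⟩ := ih
    obtain ⟨F', hF', hd⟩ := (hc.2 F hF).1 b (by cases b <;> simp)
    refine ⟨F', hF', fun e he => ?_⟩
    simp only [Front.dominates, List.all_eq_true, List.any_eq_true] at hd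
    obtain ⟨e', he', hb⟩ := hd e he
    obtain ⟨e₀, he₀, hm⟩ := List.mem_flatMap.1 (mem_of_mem_foldr_insertBest he')
    exact ((h e₀ he₀).extend hm).of_better hb

theorem exists_forces (L : List Bool) : ∃ ps, Sub ps (wordCells L) ∧ Forces (wordCells L) ps ∧
    ∃ j v, (L.map cdLen).sum = 7 * (totalWeight ps + j) + v ∧ v ≠ 1 := by
  have hc := frontsClosed_eq_true
  simp only [frontsClosed, Bool.and_eq_true, List.any_eq_true, List.all_eq_true] at hc
  obtain ⟨F, hF, h⟩ := exists_front L
  obtain ⟨e, he, h9, hv⟩ := (hc.2 F hF).2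
  obtain ⟨ps, hps, hov, j, hj⟩ := h e he
  exact ⟨ps, hps, hov.forces (by simpa [pairIdx, idx, s₀] using h9), j, e.2, hj, by simpa using hv⟩

theorem exists_forces_replicate (m : ℕ) : ∃ ps, Sub ps (wordCells (.replicate m false)) ∧
    Forces (wordCells (.replicate m false)) ps ∧ totalWeight ps ≤ m / 2 := by
  let P : List Cell := [(false, false, false), (false, false, false), (false, false, false),
    (false, false, false), (false, false, false), (true, false, false), (false, false, false),
    (false, false, false)]
  have hP : Sub P (wordCells [false, false]) := by
    simp [P, wordCells, cells, Cell.sub]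
  have even (k : ℕ) : ∃ ps, Sub ps (wordCells (.replicate (2 * k) false)) ∧
      Over (wordCells (.replicate (2 * k) false)) ps 0 ∧ totalWeight ps = k := by
    induction k with
    | zero =>
      refine ⟨[], .nil, ?_, rfl⟩
      rintro t ⟨x, -, hs, hne⟩
      cases hs
      exact (hne rfl rfl).elim
    | succ k ih =>
      obtain ⟨ps, hps, hov, hk⟩ := ih
      have hw : wordCells (.replicate (2 * (k + 1)) false) =
          wordCells (.replicate (2 * k) false) ++ wordCells [false, false] := by
        rw [← wordCells_append, mul_add, List.replicate_add]; rfl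
      rw [hw]
      refine ⟨ps ++ P, sub_append hps hP, ?_, ?_⟩
      · have := hov.run (path_wordCells _) hps (path_wordCells [false, false]) hP
        rwa [show runMask s₀ 0 (wordCells [false, false]) P = 0 by decide +kernel] at this
      · rw [totalWeight_append, hk]; rfl
  obtain ⟨ps, hps, hov, hk⟩ := even (m / 2)
  obtain h | h := Nat.mod_two_eq_zero_or_one m
  · rw [show 2 * (m / 2) = m by omega] at hps hov
    exact ⟨ps, hps, hov.forces (by simp), hk.le⟩
  · let Q : List Cell := .replicate 4 (false, false, false)
    have hQ : Sub Q (wordCells [false]) := by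
      simp [Q, wordCells, cells, Cell.sub, List.replicate]
    have hw : wordCells (.replicate m false) =
        wordCells (.replicate (2 * (m / 2)) false) ++ wordCells [false] := by
      rw [← wordCells_append, ← List.replicate_succ' (n := 2 * (m / 2)),
        show 2 * (m / 2) + 1 = m by omega]
    rw [hw]
    refine ⟨ps ++ Q, sub_append hps hQ, ?_, ?_⟩
    · refine (hov.run (path_wordCells _) hps (path_wordCells [false]) hQ).forces ?_
      decide
    · rw [totalWeight_append, hk]; rfl

/-- The paths from `s` containing the pins `ps`, with their ends. -/
def pathsThrough : Cut → List Cell → List (List Cell × Cut)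
  | s, [] => [([], s)]
  | s, p :: ps => (moves.filter fun e => e.1 = s ∧ Cell.sub p e.2).flatMap fun e =>
      (pathsThrough (nxt s e.2) ps).map fun r => (e.2 :: r.1, r.2)

theorem mem_pathsThrough {s t : Cut} {ps x : List Cell} (hx : Path s x t) (h : Sub ps x) :
    (x, t) ∈ pathsThrough s ps := by
  induction h generalizing s with
  | nil => cases hx; simp [pathsThrough]
  | @cons p y ps x hpy h ih =>
    simp only [pathsThrough, List.mem_flatMap, List.mem_filter, List.mem_map, decide_eq_true_eq]
    exact ⟨(s, y), ⟨mem_moves.2 hx.1, rfl, hpy⟩, (x, t), ih hx.2, rfl⟩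

/-- The pins `ps` determine the closed path `w` among all closed paths. -/
def ForcesClosed (w ps : List Cell) : Prop := ∀ s x, Path s x s → Sub ps x → x = w

theorem forcesClosed_append {P w Q w' : List Cell}
    (hP : ∀ s, ∀ r ∈ pathsThrough s P, s = s₀ ∧ r = (w, s₀)) (hQ : Forces w' Q) :
    ForcesClosed (w ++ w') (P ++ Q) := by
  intro s x hx hsub
  obtain ⟨x₁, x₂, h₁, h₂, rfl⟩ : ∃ x₁ x₂, Sub P x₁ ∧ Sub Q x₂ ∧ x = x₁ ++ x₂ :=
    ⟨_, _, List.forall₂_take_append x P Q hsub.flip |>.flip,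
      List.forall₂_drop_append x P Q hsub.flip |>.flip, (List.take_append_drop _ x).symm⟩
  obtain ⟨u, hu, hu'⟩ := path_append.1 hx
  obtain ⟨rfl, h⟩ := hP s _ (mem_pathsThrough hu h₁)
  simp only [Prod.mk.injEq] at h
  obtain ⟨rfl, rfl⟩ := h
  rw [hQ x₂ hu' h₂]

theorem exists_forcesClosed (L : List Bool) (hL : 34 ≤ (L.map cdLen).sum) :
    ∃ A B, L = A ++ B ∧ ∃ ps, Sub ps (wordCells (B ++ A)) ∧ ForcesClosed (wordCells (B ++ A)) ps ∧
      totalWeight ps ≤ ((L.map cdLen).sum + 9) / 7 +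
        if (L.map cdLen).sum % 7 = 3 then 1 else 0 := by
  by_cases h : true ∈ L
  · obtain ⟨A, B, rfl⟩ := List.append_of_mem h
    refine ⟨A, true :: B, rfl, ?_⟩
    obtain ⟨ps, hps, hf, j, v, hj, hv⟩ := exists_forces (B ++ A)
    refine ⟨[(true, false, false), (false, true, false), (false, false, false)] ++ ps, ?_, ?_, ?_⟩
    · rw [show true :: B ++ A = true :: (B ++ A) from rfl, wordCells_cons]
      exact sub_append (by simp [cells, Cell.sub]) hps
    · rw [show true :: B ++ A = true :: (B ++ A) from rfl, wordCells_cons]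
      exact forcesClosed_append (by decide) hf
    · rw [totalWeight_append,
        show totalWeight [(true, false, false), (false, true, false), (false, false, false)] = 2
          from rfl]
      simp only [List.map_append, List.map_cons, List.sum_append, List.sum_cons,
        show cdLen true = 3 from rfl] at hj ⊢
      split_ifs <;> omega
  · obtain ⟨m, rfl⟩ : ∃ m, L = .replicate m false :=
      ⟨_, List.eq_replicate_of_mem fun b hb => by cases b; rfl; exact (h hb).elim⟩
    simp only [List.map_replicate, List.sum_replicate, show cdLen false = 4 from rfl,
      smul_eq_mul] at hL ⊢
    obtain ⟨m, rfl⟩ : ∃ k, m = 2 + k := ⟨m - 2, by omega⟩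
    refine ⟨[], _, rfl, ?_⟩
    obtain ⟨ps, hps, hf, hm⟩ := exists_forces_replicate m
    rw [List.append_nil, List.replicate_add, wordCells_append]
    refine ⟨[(true, false, false), (false, false, false), (false, false, false),
      (false, false, true), (false, false, false), (true, false, false), (false, false, false),
      (false, false, false)] ++ ps, ?_, forcesClosed_append (by decide) hf, ?_⟩
    · exact sub_append (by simp [wordCells, cells, Cell.sub, List.replicate]) hps
    · rw [totalWeight_append]
      simp only [totalWeight, List.map_cons, List.map_nil, List.sum_cons, List.sum_nil,
        Cell.weight, Bool.toNat_true, Bool.toNat_false] at hm ⊢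
      omega

/-! ### Lower bound -/

/-- Either the pins `ps` on the path `w` from `s₀` to `m` leave an alternative with the same ends,
or they have at least the weight `e.1 + k` and leave the alternatives `e.2`, for some `e ∈ Φ`. -/
def Covers (Φ : List (ℕ × ℕ)) (k : ℕ) (w ps : List Cell) (m : Cut) : Prop :=
  Alt w ps s₀ m ∨ ∃ e ∈ Φ, e.1 + k ≤ totalWeight ps ∧
    ∀ s t, e.2.testBit (pairIdx s t) = true → Alt w ps s t

/-- `e` has at most the weight and at most the alternatives of `e'`. -/
def lower (e e' : ℕ × ℕ) : Bool := e.1 ≤ e'.1 && e.2 &&& e'.2 == e.2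

theorem lower_refl (e : ℕ × ℕ) : lower e e = true := by simp [lower]

theorem lower_trans {e e' e'' : ℕ × ℕ} (h : lower e e' = true) (h' : lower e' e'' = true) :
    lower e e'' = true := by
  simp only [lower, Bool.and_eq_true, decide_eq_true_eq, beq_iff_eq] at *
  exact ⟨h.1.trans h'.1, by rw [← h.2, Nat.and_assoc, h'.2]⟩

def insertLow (e : ℕ × ℕ) (Φ : List (ℕ × ℕ)) : List (ℕ × ℕ) :=
  if Φ.any (lower · e) then Φ else e :: Φ.filter fun e' => !lower e e'

theorem exists_lower_mem_prune {e : ℕ × ℕ} {l : List (ℕ × ℕ)} (h : e ∈ l) :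
    ∃ e' ∈ l.foldr insertLow [], lower e' e = true := by
  induction l with
  | nil => simp at h
  | cons a l ih =>
    rw [List.foldr_cons, insertLow]
    rcases List.mem_cons.1 h with rfl | h
    · split_ifs with h'
      · simpa using h'
      · exact ⟨e, List.mem_cons_self, lower_refl e⟩
    · obtain ⟨e', he', hl⟩ := ih h
      split_ifs with h'
      · exact ⟨e', he', hl⟩
      · cases ha : lower a e' with
        | true => exact ⟨a, List.mem_cons_self, lower_trans ha hl⟩
        | false =>
          exact ⟨e', List.mem_cons_of_mem _ (List.mem_filter.2 ⟨he', by simp [ha]⟩), hl⟩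

def subcells (y : Cell) : List Cell :=
  (do let a ← [false, true]; let b ← [false, true]; let c ← [false, true]; pure (a, b, c)
    : List Cell).filter (Cell.sub · y)

theorem mem_subcells {p y : Cell} : p ∈ subcells y ↔ Cell.sub p y = true := by
  revert p y; decide

def stepStates (m : Cut) (y : Cell) (Φ : List (ℕ × ℕ)) : List (ℕ × ℕ) :=
  ((Φ.flatMap fun e => (subcells y).map fun p => (e.1 + p.weight, stepMask m y p e.2)).filter
    fun e => !e.2.testBit (pairIdx s₀ (nxt m y))).foldr insertLow []

theorem Covers.lower {Φ : List (ℕ × ℕ)} {k : ℕ} {w ps : List Cell} {m : Cut}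
    {e : ℕ × ℕ} (hk : e.1 + k ≤ totalWeight ps)
    (hX : ∀ s t, e.2.testBit (pairIdx s t) = true → Alt w ps s t)
    (h : ∃ e' ∈ Φ, PetersenForcing.lower e' e = true) : Covers Φ k w ps m := by
  obtain ⟨e', he', hl⟩ := h
  simp only [PetersenForcing.lower, Bool.and_eq_true, decide_eq_true_eq, beq_iff_eq] at hl
  refine Or.inr ⟨e', he', by omega, fun s t hb => hX s t ?_⟩
  rw [← hl.2, Nat.testBit_and, Bool.and_eq_true] at hb
  exact hb.2

theorem Covers.step {Φ : List (ℕ × ℕ)} {k : ℕ} {w ps : List Cell} {m : Cut} {y p : Cell}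
    (h : Covers Φ k w ps m) (hm : Path s₀ w m) (hps : Sub ps w) (hp : Cell.sub p y = true)
    (hok : ok m y = true) :
    Covers (stepStates m y Φ) k (w ++ [y]) (ps ++ [p]) (nxt m y) := by
  rcases h with h | ⟨e, he, hk, hX⟩
  · exact Or.inl ((alt_snoc hm hps).2 ⟨m, y, ⟨hok, rfl, hp⟩, Or.inl h⟩)
  · have hX' : ∀ s t, (stepMask m y p e.2).testBit (pairIdx s t) = true →
        Alt (w ++ [y]) (ps ++ [p]) s t := by
      intro s t hb
      obtain ⟨u, z, h, h'⟩ := testBit_stepMask.1 hb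
      exact (alt_snoc hm hps).2 ⟨u, z, h, h'.imp_left (hX s u)⟩
    cases hb : (stepMask m y p e.2).testBit (pairIdx s₀ (nxt m y)) with
    | true => exact Or.inl (hX' _ _ hb)
    | false =>
      refine Covers.lower (e := (e.1 + p.weight, stepMask m y p e.2)) ?_ hX'
        (exists_lower_mem_prune ?_)
      · rw [totalWeight_append, show totalWeight [p] = p.weight from rfl]
        simp only
        omega
      · simp only [List.mem_filter, List.mem_flatMap, List.mem_map, hb, Bool.not_false, and_true]
        exact ⟨e, he, p, mem_subcells.2 hp, rfl⟩

def runStates : Cut → List (ℕ × ℕ) → List Cell → List (ℕ × ℕ)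
  | _, Φ, [] => Φ
  | m, Φ, y :: ys => runStates (nxt m y) (stepStates m y Φ) ys

theorem Covers.run {Φ : List (ℕ × ℕ)} {k : ℕ} {w ps ys qs : List Cell} {m m' : Cut}
    (h : Covers Φ k w ps m) (hm : Path s₀ w m) (hps : Sub ps w) (hm' : Path m ys m')
    (hqs : Sub qs ys) : Covers (runStates m Φ ys) k (w ++ ys) (ps ++ qs) m' := by
  induction hqs generalizing w ps Φ m with
  | nil =>
    cases hm'
    simpa [runStates] using h
  | @cons q y qs ys hq hqs ih =>
    have hw : Path s₀ (w ++ [y]) (nxt m y) := path_snoc.2 ⟨m, hm, hm'.1, rfl⟩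
    simpa [runStates] using
      ih (h.step hm hps hq hm'.1) hw (sub_append hps (.cons hq .nil)) hm'.2

/-- All pairs `(s, s)` with `s ≠ s₀`. -/
def startMask : ℕ := 2 ^ 0 + 2 ^ 18 + 2 ^ 27 + 2 ^ 36 + 2 ^ 45 + 2 ^ 54 + 2 ^ 63

theorem testBit_startMask {s t : Cut} :
    startMask.testBit (pairIdx s t) = true ↔ s = t ∧ s ≠ s₀ := by
  revert s t; decide

theorem covers_nil : Covers [(0, startMask)] 0 [] [] s₀ := by
  refine Or.inr ⟨_, List.mem_singleton_self _, le_rfl, fun s t h => ?_⟩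
  obtain ⟨rfl, hs⟩ := testBit_startMask.1 h
  exact ⟨[], rfl, .nil, fun h => (hs h).elim⟩

def statesCD : List (ℕ × ℕ) := runStates s₀ [(0, startMask)] (wordCells [true, false])

def statesCDStable : Bool :=
  (runStates s₀ statesCD (wordCells [true, false])).all fun e =>
    statesCD.any fun e' => lower (e'.1 + 1, e'.2) e

theorem statesCDStable_eq_true : statesCDStable = true := by decide +kernel

/-- The word `(CD)^k`. -/
def wordCD (k : ℕ) : List Bool := (List.replicate k [true, false]).flatten

theorem exists_eq_append_of_sub {ps x y : List Cell} (h : Sub ps (x ++ y)) :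
    ∃ ps₁ ps₂, Sub ps₁ x ∧ Sub ps₂ y ∧ ps = ps₁ ++ ps₂ :=
  ⟨_, _, List.forall₂_take_append ps x y h, List.forall₂_drop_append ps x y h,
    (List.take_append_drop _ _).symm⟩

theorem covers_wordCD (k : ℕ) {ps : List Cell} (hps : Sub ps (wordCells (wordCD (k + 1)))) :
    Covers statesCD k (wordCells (wordCD (k + 1))) ps s₀ := by
  induction k generalizing ps with
  | zero => exact covers_nil.run rfl .nil (path_wordCells [true, false]) hps
  | succ k ih =>
    have hw : wordCells (wordCD (k + 1 + 1)) =
        wordCells (wordCD (k + 1)) ++ wordCells [true, false] := by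
      rw [← wordCells_append, wordCD, List.replicate_succ', List.flatten_append]
      simp [wordCD]
    rw [hw] at hps ⊢
    obtain ⟨ps, qs, hps', hqs, rfl⟩ := exists_eq_append_of_sub hps
    rcases (ih hps').run (path_wordCells _) hps' (path_wordCells _) hqs with h | ⟨e, he, hk, hX⟩
    · exact Or.inl h
    · have hs := statesCDStable_eq_true
      simp only [statesCDStable, List.all_eq_true, List.any_eq_true] at hs
      obtain ⟨e', he', hl⟩ := hs e he
      simp only [lower, Bool.and_eq_true, decide_eq_true_eq, beq_iff_eq] at hl
      refine Or.inr ⟨e', he', by omega, fun s t hb => hX s t ?_⟩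
      rw [← hl.2, Nat.testBit_and, Bool.and_eq_true] at hb
      exact hb.2

/-- The value of the maximum forcing number. -/
def maxForcing (n : ℕ) : ℕ := (n + 9) / 7 + if n % 7 = 3 then 1 else 0

def suffixHard (S : List Bool) : Bool :=
  (runStates s₀ statesCD (wordCells S)).all fun e =>
    maxForcing (S.map cdLen).sum + 1 ≤ e.1 || (List.range 8).any fun i => e.2.testBit (9 * i)

theorem exists_idx_eq {i : ℕ} (hi : i < 8) : ∃ s, idx s = i := by revert i; decide

theorem length_wordCD (k : ℕ) : ((wordCD k).map cdLen).sum = 7 * k := by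
  induction k with
  | zero => rfl
  | succ k ih =>
    rw [wordCD, List.replicate_succ, List.flatten_cons]
    simp only [List.map_append, List.sum_append]
    rw [← wordCD, ih]
    simp only [List.map_cons, List.map_nil, List.sum_cons, List.sum_nil, cdLen]
    simp only [if_true, Bool.false_eq_true, if_false]
    ring

theorem maxForcing_add (k n : ℕ) : maxForcing (7 * k + n) = k + maxForcing n := by
  unfold maxForcing
  split_ifs <;> omega

theorem start_eq_of_path_cells_true {s t : Cut} (h : Path s (cells true) t) : s = s₀ := by
  obtain ⟨a, b, c⟩ := s
  revert h
  cases a <;> cases b <;> cases c <;> simp [Path, cells, ok, exactlyOne, nxt, s₀]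

theorem exists_closed_alternative {k : ℕ} {S : List Bool} (hS : suffixHard S = true)
    {ps : List Cell} (hps : Sub ps (wordCells (wordCD (k + 1) ++ S)))
    (hlt : totalWeight ps < maxForcing (((wordCD (k + 1) ++ S).map cdLen).sum)) :
    ∃ s x, Path s x s ∧ Sub ps x ∧ x ≠ wordCells (wordCD (k + 1) ++ S) := by
  have alt : ∃ s, Alt (wordCells (wordCD (k + 1) ++ S)) ps s s := by
    rw [List.map_append, List.sum_append, length_wordCD, maxForcing_add] at hlt
    rw [wordCells_append] at hps ⊢
    obtain ⟨ps, qs, hps', hqs, rfl⟩ := exists_eq_append_of_sub hps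
    rcases (covers_wordCD k hps').run (path_wordCells _) hps' (path_wordCells S) hqs with
      h | ⟨e, he, hk, hX⟩
    · exact ⟨s₀, h⟩
    · simp only [suffixHard, List.all_eq_true, Bool.or_eq_true, decide_eq_true_eq,
        List.any_eq_true, List.mem_range] at hS
      rcases hS e he with h | ⟨i, hi, hb⟩
      · omega
      · obtain ⟨s, rfl⟩ := exists_idx_eq hi
        exact ⟨s, hX s s (by rwa [pairIdx, show 8 * idx s + idx s = 9 * idx s by ring])⟩
  obtain ⟨s, x, hx, hsub, hne⟩ := alt
  refine ⟨s, x, hx, hsub, ?_⟩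
  rintro rfl
  refine hne ?_ rfl
  rw [wordCD, List.replicate_succ, List.flatten_cons, List.cons_append, List.cons_append,
    wordCells_cons] at hx
  obtain ⟨u, hu, -⟩ := path_append.1 hx
  exact start_eq_of_path_cells_true hu

theorem suffixHard_eq_true : [[], [true], [true, true], [true, true, true], [false],
    [false, false], [true, true, false, true, true, false, true, true, false, true]].all
      suffixHard = true := by decide +kernel

theorem exists_hard_word {n : ℕ} (hn : 34 ≤ n) : ∃ L : List Bool, (L.map cdLen).sum = n ∧
    ∀ ps, Sub ps (wordCells L) → totalWeight ps < maxForcing n →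
      ∃ s x, Path s x s ∧ Sub ps x ∧ x ≠ wordCells L := by
  have hard := suffixHard_eq_true
  simp only [List.all_cons, List.all_nil, Bool.and_true, Bool.and_eq_true] at hard
  have main {S : List Bool} (hS : suffixHard S = true) (h7 : (S.map cdLen).sum + 7 ≤ n)
      (hmod : (n - (S.map cdLen).sum) % 7 = 0) : ∃ L : List Bool, (L.map cdLen).sum = n ∧
        ∀ ps, Sub ps (wordCells L) → totalWeight ps < maxForcing n →
          ∃ s x, Path s x s ∧ Sub ps x ∧ x ≠ wordCells L := by
    obtain ⟨k, hk⟩ : ∃ k, n = 7 * (k + 1) + (S.map cdLen).sum :=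
      ⟨(n - (S.map cdLen).sum) / 7 - 1, by omega⟩
    have hsum : ((wordCD (k + 1) ++ S).map cdLen).sum = n := by
      rw [List.map_append, List.sum_append, length_wordCD, hk]
    refine ⟨_, hsum, fun ps hps hlt => exists_closed_alternative hS hps ?_⟩
    rwa [hsum]
  obtain ⟨h0, h3, h6, h2, h4, h1, h5⟩ := hard
  have : n % 7 < 7 := Nat.mod_lt _ (by norm_num)
  interval_cases hr : n % 7
  · exact main h0 (by simp; omega) (by simp; omega)
  · exact main h1 (by simp [cdLen]; omega) (by simp [cdLen]; omega)
  · exact main h2 (by simp [cdLen]; omega) (by simp [cdLen]; omega)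
  · exact main h3 (by simp [cdLen]; omega) (by simp [cdLen]; omega)
  · exact main h4 (by simp [cdLen]; omega) (by simp [cdLen]; omega)
  · exact main h5 (by simp [cdLen]; omega) (by simp [cdLen]; omega)
  · exact main h6 (by simp [cdLen]; omega) (by simp [cdLen]; omega)

/-! ### Edge sets of assignments of cells -/

section Graph

variable {n : ℕ}

def Cell.bit (y : Cell) : Fin 3 → Bool := ![y.1, y.2.1, y.2.2]

theorem Cell.sub_iff {p y : Cell} : Cell.sub p y = true ↔ ∀ c, p.bit c = true → y.bit c = true := by
  revert p y; decide

theorem Cell.weight_eq_sum (p : Cell) : p.weight = ∑ c, (p.bit c).toNat := by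
  revert p; decide

theorem Cell.ext_bit {p y : Cell} (h : ∀ c, p.bit c = true ↔ y.bit c = true) : p = y := by
  revert p y; decide

def edge (j : ZMod n) : Fin 3 → Sym2 (PV n) :=
  ![s(pu j, pu (j + 2)), s(pu j, pv j), s(pv j, pv (j + 1))]

/-- The edges selected by an assignment of cells to the positions. -/
def edgesOf (f : ZMod n → Cell) : Set (Sym2 (PV n)) :=
  {e | ∃ j c, (f j).bit c = true ∧ e = edge j c}

theorem two_ne_zero_of_four (h4 : (4 : ZMod n) ≠ 0) : (2 : ZMod n) ≠ 0 := fun h =>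
  h4 (by rw [show (4 : ZMod n) = 2 * 2 by norm_num, h, zero_mul])

theorem one_ne_zero_of_four (h4 : (4 : ZMod n) ≠ 0) : (1 : ZMod n) ≠ 0 := fun h =>
  h4 (by rw [show (4 : ZMod n) = 4 * 1 by norm_num, h, mul_zero])

theorem edge_injective (h4 : (4 : ZMod n) ≠ 0) {j k : ZMod n} {c d : Fin 3}
    (h : edge j c = edge k d) : j = k ∧ c = d := by
  have h2 := two_ne_zero_of_four h4
  fin_cases c <;> fin_cases d <;>
    simp only [edge, pu, pv, Fin.zero_eta, Fin.mk_one, Fin.reduceFinMk, Matrix.cons_val,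
      Sym2.eq_iff, Sum.inl.injEq, Sum.inr.injEq, reduceCtorEq, and_false, false_and, or_self,
      or_false, and_true, and_self] at h ⊢
  · rcases h with h | ⟨rfl, h⟩
    · exact h.1
    · exact (h4 (by linear_combination h)).elim
  · exact h
  · rcases h with h | ⟨rfl, h⟩
    · exact h.1
    · exact (h2 (by linear_combination h)).elim

theorem edge_mem_edgesOf (h4 : (4 : ZMod n) ≠ 0) {f : ZMod n → Cell} {j : ZMod n} {c : Fin 3} :
    edge j c ∈ edgesOf f ↔ (f j).bit c = true := by
  refine ⟨?_, fun h => ⟨j, c, h, rfl⟩⟩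
  rintro ⟨k, d, h, he⟩
  obtain ⟨rfl, rfl⟩ := edge_injective h4 he
  exact h

theorem edgesOf_subset_iff (h4 : (4 : ZMod n) ≠ 0) {p f : ZMod n → Cell} :
    edgesOf p ⊆ edgesOf f ↔ ∀ j, Cell.sub (p j) (f j) = true := by
  simp only [Cell.sub_iff]
  constructor
  · exact fun h j c hc => (edge_mem_edgesOf h4).1 (h ⟨j, c, hc, rfl⟩)
  · rintro h e ⟨j, c, hc, rfl⟩
    exact ⟨j, c, h j c hc, rfl⟩

theorem edgesOf_injective (h4 : (4 : ZMod n) ≠ 0) {f g : ZMod n → Cell}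
    (h : edgesOf f = edgesOf g) : f = g := by
  funext j
  refine Cell.ext_bit fun c => ?_
  rw [← edge_mem_edgesOf h4, h, edge_mem_edgesOf h4]

theorem ncard_edgesOf [NeZero n] (h4 : (4 : ZMod n) ≠ 0) (f : ZMod n → Cell) :
    (edgesOf f).ncard = ∑ j, (f j).weight := by
  have himage : edgesOf f = Set.image (fun a : ZMod n × Fin 3 => edge a.1 a.2)
      {a | (f a.1).bit a.2 = true} := by
    ext e
    simp only [edgesOf, Set.mem_ofPred_eq, Set.mem_image, Prod.exists]
    exact exists₂_congr fun j c => and_congr_right fun _ => eq_comm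
  have hinj : Function.Injective fun a : ZMod n × Fin 3 => edge a.1 a.2 := fun a b h =>
    Prod.ext (edge_injective h4 h).1 (edge_injective h4 h).2
  rw [himage, Set.ncard_image_of_injective _ hinj, Set.ncard_eq_toFinset_card',
    Set.toFinset_ofPred, Finset.card_filter, Fintype.sum_prod_type]
  refine Finset.sum_congr rfl fun j _ => ?_
  rw [Cell.weight_eq_sum]
  refine Finset.sum_congr rfl fun c _ => ?_
  cases (f j).bit c <;> rfl

theorem mem_edgesOf {f : ZMod n → Cell} {e : Sym2 (PV n)} :
    e ∈ edgesOf f ↔ ∃ j, ((f j).1 = true ∧ e = s(pu j, pu (j + 2))) ∨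
      ((f j).2.1 = true ∧ e = s(pu j, pv j)) ∨ ((f j).2.2 = true ∧ e = s(pv j, pv (j + 1))) := by
  simp [edgesOf, Fin.exists_fin_succ, Cell.bit, edge]

theorem mem_edgesOf_pu {f : ZMod n → Cell} {j : ZMod n} {w : PV n} :
    s(pu j, w) ∈ edgesOf f ↔ (w = pu (j - 2) ∧ (f (j - 2)).1 = true) ∨
      (w = pv j ∧ (f j).2.1 = true) ∨ (w = pu (j + 2) ∧ (f j).1 = true) := by
  rw [mem_edgesOf]
  rcases w with k | k <;>
    simp only [pu, pv, Sym2.eq_iff, Sum.inl.injEq, Sum.inr.injEq, reduceCtorEq, and_false,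
      false_and, or_false, false_or]
  · constructor
    · rintro ⟨i, h, ⟨rfl, rfl⟩ | ⟨rfl, rfl⟩⟩
      · exact Or.inr ⟨rfl, h⟩
      · simp [h]
    · rintro (⟨rfl, h⟩ | ⟨rfl, h⟩)
      · exact ⟨_, h, Or.inr ⟨by ring, rfl⟩⟩
      · exact ⟨_, h, Or.inl ⟨rfl, rfl⟩⟩
  · constructor
    · rintro ⟨i, h, rfl, rfl⟩
      exact ⟨rfl, h⟩
    · rintro ⟨rfl, h⟩
      exact ⟨_, h, rfl, rfl⟩

theorem mem_edgesOf_pv {f : ZMod n → Cell} {j : ZMod n} {w : PV n} :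
    s(pv j, w) ∈ edgesOf f ↔ (w = pv (j - 1) ∧ (f (j - 1)).2.2 = true) ∨
      (w = pu j ∧ (f j).2.1 = true) ∨ (w = pv (j + 1) ∧ (f j).2.2 = true) := by
  rw [mem_edgesOf]
  rcases w with k | k <;>
    simp only [pu, pv, Sym2.eq_iff, Sum.inl.injEq, Sum.inr.injEq, reduceCtorEq, and_false,
      false_and, or_false, false_or]
  · constructor
    · rintro ⟨i, h, rfl, rfl⟩
      exact ⟨rfl, h⟩
    · rintro ⟨rfl, h⟩
      exact ⟨_, h, rfl, rfl⟩
  · constructor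
    · rintro ⟨i, h, ⟨rfl, rfl⟩ | ⟨rfl, rfl⟩⟩
      · exact Or.inr ⟨rfl, h⟩
      · simp [h]
    · rintro (⟨rfl, h⟩ | ⟨rfl, h⟩)
      · exact ⟨_, h, Or.inr ⟨by ring, rfl⟩⟩
      · exact ⟨_, h, Or.inl ⟨rfl, rfl⟩⟩

theorem existsUnique_iff_exactlyOne {α : Type*} {a b c : α} (hab : a ≠ b) (hac : a ≠ c)
    (hbc : b ≠ c) {A B C : Bool} :
    (∃! w, (w = a ∧ A = true) ∨ (w = b ∧ B = true) ∨ (w = c ∧ C = true)) ↔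
      exactlyOne A B C = true := by
  cases A <;> cases B <;> cases C <;> simp [ExistsUnique, exactlyOne, hab, hac, hbc,
    hab.symm, hac.symm, hbc.symm]

/-- The cut before position `j`. -/
def cutAt (f : ZMod n → Cell) (j : ZMod n) : Cut :=
  ((f (j - 2)).1, (f (j - 1)).1, (f (j - 1)).2.2)

theorem nxt_cutAt (f : ZMod n → Cell) (j : ZMod n) : nxt (cutAt f j) (f j) = cutAt f (j + 1) := by
  simp [nxt, cutAt, show j + 1 - 2 = j - 1 by ring]

def Valid (f : ZMod n → Cell) : Prop := ∀ j, ok (cutAt f j) (f j) = true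

theorem valid_iff (h4 : (4 : ZMod n) ≠ 0) {f : ZMod n → Cell} :
    Valid f ↔ ∀ v, ∃! w, s(v, w) ∈ edgesOf f := by
  have h2 := two_ne_zero_of_four h4
  have hu (j : ZMod n) : (∃! w, s(pu j, w) ∈ edgesOf f) ↔
      exactlyOne (f (j - 2)).1 (f j).2.1 (f j).1 = true := by
    simp only [mem_edgesOf_pu]
    refine existsUnique_iff_exactlyOne (by simp [pu, pv]) ?_ (by simp [pu, pv])
    intro h
    exact h4 (by linear_combination -Sum.inl_injective h)
  have hv (j : ZMod n) : (∃! w, s(pv j, w) ∈ edgesOf f) ↔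
      exactlyOne (f (j - 1)).2.2 (f j).2.1 (f j).2.2 = true := by
    simp only [mem_edgesOf_pv]
    refine existsUnique_iff_exactlyOne (by simp [pu, pv]) ?_ (by simp [pu, pv])
    intro h
    exact h2 (by linear_combination -Sum.inr_injective h)
  have hall (P : PV n → Prop) : (∀ v, P v) ↔ ∀ j, P (pu j) ∧ P (pv j) :=
    ⟨fun h j => ⟨h _, h _⟩, fun h v => v.rec (fun j => (h j).1) fun j => (h j).2⟩
  rw [hall]
  simp only [hu, hv, Valid, ok, cutAt, Bool.and_eq_true]

theorem petersen_adj_iff (h4 : (4 : ZMod n) ≠ 0) {v w : PV n} :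
    (petersen n).Adj v w ↔ s(v, w) ∈ edgesOf (n := n) fun _ => (true, true, true) := by
  have h2 := two_ne_zero_of_four h4
  have h1 := one_ne_zero_of_four h4
  simp only [mem_edgesOf, true_and, petersen, fromRel_adj, Sym2.eq_iff]
  constructor
  · rintro ⟨-, (⟨j, h⟩ | ⟨j, h⟩ | ⟨j, h⟩) | ⟨j, h⟩ | ⟨j, h⟩ | ⟨j, h⟩⟩ <;> exact ⟨j, by tauto⟩
  · rintro ⟨j, h⟩
    refine ⟨?_, ?_⟩
    · rintro rfl
      rcases h with (h | h) | (h | h) | (h | h) <;> obtain ⟨rfl, h⟩ := h <;>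
        simp [pu, pv, h1, h2] at h
    · rcases h with (h | h) | (h | h) | (h | h)
      · exact Or.inl (Or.inl ⟨j, h⟩)
      · exact Or.inr (Or.inl ⟨j, h.symm⟩)
      · exact Or.inl (Or.inr (Or.inl ⟨j, h⟩))
      · exact Or.inr (Or.inr (Or.inl ⟨j, h.symm⟩))
      · exact Or.inl (Or.inr (Or.inr ⟨j, h⟩))
      · exact Or.inr (Or.inr (Or.inr ⟨j, h.symm⟩))

theorem edgeSet_petersen (h4 : (4 : ZMod n) ≠ 0) :
    (petersen n).edgeSet = edgesOf fun _ => (true, true, true) := by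
  ext e
  induction e with
  | _ v w => exact petersen_adj_iff h4

theorem exists_edgesOf_eq (h4 : (4 : ZMod n) ≠ 0) {S : Set (Sym2 (PV n))}
    (hS : S ⊆ (petersen n).edgeSet) : ∃ f, edgesOf f = S := by
  classical
  refine ⟨fun j => (decide (edge j 0 ∈ S), decide (edge j 1 ∈ S), decide (edge j 2 ∈ S)), ?_⟩
  have hbit (j : ZMod n) (c : Fin 3) : Cell.bit (decide (edge j 0 ∈ S), decide (edge j 1 ∈ S),
      decide (edge j 2 ∈ S)) c = true ↔ edge j c ∈ S := by
    fin_cases c <;> simp [Cell.bit]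
  ext e
  constructor
  · rintro ⟨j, c, hc, rfl⟩
    exact (hbit j c).1 hc
  · intro he
    have := hS he
    rw [edgeSet_petersen h4] at this
    obtain ⟨j, c, -, rfl⟩ := this
    exact ⟨j, c, (hbit j c).2 he, rfl⟩

theorem isPerfectMatching_iff_existsUnique {M : (petersen n).Subgraph} :
    M.IsPerfectMatching ↔ ∀ v, ∃! w, s(v, w) ∈ M.edgeSet := Subgraph.isPerfectMatching_iff

theorem exists_valid (h4 : (4 : ZMod n) ≠ 0) {M : (petersen n).Subgraph}
    (hM : M.IsPerfectMatching) : ∃ f, Valid f ∧ edgesOf f = M.edgeSet := by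
  obtain ⟨f, hf⟩ := exists_edgesOf_eq h4 M.edgeSet_subset
  refine ⟨f, (valid_iff h4).2 ?_, hf⟩
  rw [hf]
  exact isPerfectMatching_iff_existsUnique.1 hM

theorem exists_isPerfectMatching (h4 : (4 : ZMod n) ≠ 0) {f : ZMod n → Cell} (hf : Valid f) :
    ∃ M : (petersen n).Subgraph, M.IsPerfectMatching ∧ M.edgeSet = edgesOf f := by
  have hsub : edgesOf f ⊆ (petersen n).edgeSet := by
    rw [edgeSet_petersen h4, edgesOf_subset_iff h4]
    intro j
    simp [Cell.sub]
  let M : (petersen n).Subgraph :=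
    { verts := Set.univ
      Adj := fun v w => s(v, w) ∈ edgesOf f
      adj_sub := fun h => hsub h
      edge_vert := fun _ => Set.mem_univ _
      symm := ⟨fun v w h => by rwa [Sym2.eq_swap]⟩ }
  have hM : M.edgeSet = edgesOf f := by
    ext e
    induction e with
    | _ v w => rfl
  refine ⟨M, isPerfectMatching_iff_existsUnique.2 ?_, hM⟩
  rw [hM]
  exact (valid_iff h4).1 hf

theorem eq_of_edgeSet_eq {M M' : (petersen n).Subgraph} (hM : M.IsPerfectMatching)
    (hM' : M'.IsPerfectMatching) (h : M.edgeSet = M'.edgeSet) : M = M' := by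
  refine Subgraph.ext ?_ ?_
  · rw [Subgraph.isSpanning_iff.1 hM.2, Subgraph.isSpanning_iff.1 hM'.2]
  · ext v w
    exact Set.ext_iff.1 h s(v, w)

/-! ### Assignments of cells as lists -/

/-- The cells at the positions `b, …, b + k - 1`. -/
def toList (b : ZMod n) (f : ZMod n → Cell) (k : ℕ) : List Cell :=
  (List.range k).map fun i : ℕ => f (b + i)

theorem toList_succ (b : ZMod n) (f : ZMod n → Cell) (k : ℕ) :
    toList b f (k + 1) = toList b f k ++ [f (b + k)] := by
  simp [toList, List.range_succ]

theorem Valid.path {f : ZMod n → Cell} (hf : Valid f) (b : ZMod n) (k : ℕ) :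
    Path (cutAt f b) (toList b f k) (cutAt f (b + k)) := by
  induction k with
  | zero => simp [toList, Path]
  | succ k ih =>
    rw [toList_succ]
    exact path_snoc.2 ⟨_, ih, hf _, by rw [nxt_cutAt, Nat.cast_succ, add_assoc]⟩

theorem Valid.closed_path {f : ZMod n → Cell} (hf : Valid f) (b : ZMod n) :
    Path (cutAt f b) (toList b f n) (cutAt f b) := by
  simpa using hf.path b n

theorem eq_cutAt_of_path {f : ZMod n → Cell} {b : ZMod n} {s t : Cut} {k : ℕ} (hk : 2 ≤ k)
    (h : Path s (toList b f k) t) : t = cutAt f (b + k) := by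
  obtain ⟨k, rfl⟩ := Nat.exists_eq_add_of_le' hk
  rw [toList_succ, toList_succ] at h
  obtain ⟨u, hu, -, rfl⟩ := path_snoc.1 h
  obtain ⟨u, -, -, rfl⟩ := path_snoc.1 hu
  simp only [nxt, cutAt, Nat.cast_add, Nat.cast_ofNat, Nat.cast_one]
  rw [show b + (k + 2) - 2 = b + (k : ZMod n) by ring,
    show b + (k + 2) - 1 = b + ((k : ZMod n) + 1) by ring]

theorem ok_of_path {f : ZMod n → Cell} {b : ZMod n} {t : Cut} {k : ℕ}
    (h : Path (cutAt f b) (toList b f k) t) :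
    t = cutAt f (b + k) ∧ ∀ i < k, ok (cutAt f (b + i)) (f (b + i)) = true := by
  induction k generalizing t with
  | zero => exact ⟨by simpa [toList, Path] using (Eq.symm h : t = _), by simp⟩
  | succ k ih =>
    rw [toList_succ] at h
    obtain ⟨u, hu, hok, rfl⟩ := path_snoc.1 h
    obtain ⟨rfl, hlt⟩ := ih hu
    refine ⟨by rw [nxt_cutAt, Nat.cast_succ, add_assoc], fun i hi => ?_⟩
    rcases Nat.lt_succ_iff_lt_or_eq.1 hi with hi | rfl
    · exact hlt i hi
    · exact hok

/-- The edges of the cells `x` placed at the positions from `i` on. -/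
def listEdges : ZMod n → List Cell → Set (Sym2 (PV n))
  | _, [] => ∅
  | i, y :: x => {e | ∃ c, y.bit c = true ∧ e = edge i c} ∪ listEdges (i + 1) x

theorem listEdges_append (i : ZMod n) (x y : List Cell) :
    listEdges i (x ++ y) = listEdges i x ∪ listEdges (i + (x.length : ZMod n)) y := by
  induction x generalizing i with
  | nil => simp [listEdges]
  | cons z x ih =>
    simp [listEdges, ih, Set.union_assoc, add_assoc, add_comm (1 : ZMod n)]

theorem cdEdges_eq_listEdges (i : ZMod n) (L : List Bool) :
    cdEdges n i L = listEdges i (wordCells L) := by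
  induction L generalizing i with
  | nil => rfl
  | cons b L ih =>
    have h2 : i + 1 + 1 = i + 2 := by ring
    have h3 : i + 2 + 1 = i + 3 := by ring
    have h4 : i + 3 + 1 = i + 4 := by ring
    have h5 : i + 1 + 2 = i + 3 := by ring
    rw [wordCells_cons, listEdges_append, length_cells]
    cases b
    · rw [cdEdges, ih]
      congr 1
      ext e
      simp [cells, listEdges, blockD, Fin.exists_fin_succ, Cell.bit, edge, h2, h3, h4, h5]
      tauto
    · rw [cdEdges, ih]
      congr 1
      ext e
      simp [cells, listEdges, blockC, Fin.exists_fin_succ, Cell.bit, edge, h2, h3, h5]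
      tauto

theorem toList_rotate {b : ZMod n} {f : ZMod n → Cell} {x y : List Cell}
    (h : toList b f n = x ++ y) : toList (b + (x.length : ZMod n)) f n = y ++ x := by
  rw [← List.rotate_append_length_eq, ← h]
  refine List.ext_getElem (by simp [toList]) fun i _ _ => ?_
  simp [toList, List.getElem_rotate, add_assoc, add_comm (i : ZMod n) x.length]

variable [NeZero n]

theorem exists_lt_eq_add (b j : ZMod n) : ∃ i < n, j = b + (i : ℕ) :=
  ⟨(j - b).val, ZMod.val_lt _, by simp⟩

theorem valid_of_path (hn : 2 ≤ n) {f : ZMod n → Cell} {b : ZMod n} {s : Cut}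
    (h : Path s (toList b f n) s) : Valid f := by
  have hs := eq_cutAt_of_path hn h
  rw [ZMod.natCast_self, add_zero] at hs
  subst hs
  intro j
  obtain ⟨i, hi, rfl⟩ := exists_lt_eq_add b j
  exact (ok_of_path h).2 i hi

theorem toList_injective {b : ZMod n} {f g : ZMod n → Cell} (h : toList b f n = toList b g n) :
    f = g := by
  funext j
  obtain ⟨i, hi, rfl⟩ := exists_lt_eq_add b j
  simp only [toList, List.map_inj_left, List.mem_range] at h
  exact h i hi

theorem exists_toList_eq (b : ZMod n) {x : List Cell} (hx : x.length = n) :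
    ∃ f, toList b f n = x := by
  refine ⟨fun j => x[(j - b).val]'((ZMod.val_lt _).trans_eq hx.symm),
    List.ext_getElem (by simp [toList, hx]) ?_⟩
  intro i h _
  have hi : i < n := by simpa [toList] using h
  simp [toList, Nat.mod_eq_of_lt hi]

theorem sub_toList_iff {b : ZMod n} {p f : ZMod n → Cell} :
    Sub (toList b p n) (toList b f n) ↔ ∀ j, Cell.sub (p j) (f j) = true := by
  simp only [Sub, toList, List.forall₂_map_left_iff, List.forall₂_map_right_iff,
    List.forall₂_same, List.mem_range]
  constructor
  · intro h j
    obtain ⟨i, hi, rfl⟩ := exists_lt_eq_add b j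
    exact h i hi
  · exact fun h i _ => h _

theorem totalWeight_toList (b : ZMod n) (p : ZMod n → Cell) :
    totalWeight (toList b p n) = ∑ j, (p j).weight := by
  rw [totalWeight, toList, List.map_map, ← List.sum_toFinset _ List.nodup_range,
    List.toFinset_range]
  refine Finset.sum_nbij' (fun i : ℕ => b + i) (fun j => (j - b).val) (by simp)
    (fun j _ => Finset.mem_range.2 (ZMod.val_lt _)) (fun i hi => ?_) (by simp) (by simp)
  simp [Nat.mod_eq_of_lt (Finset.mem_range.1 hi)]

theorem listEdges_toList (b : ZMod n) (f : ZMod n → Cell) :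
    listEdges b (toList b f n) = edgesOf f := by
  have key (k : ℕ) : listEdges b (toList b f k) =
      {e | ∃ i < k, ∃ c, (f (b + ((i : ℕ) : ZMod n))).bit c = true ∧
        e = edge (b + ((i : ℕ) : ZMod n)) c} := by
    induction k with
    | zero => simp [toList, listEdges]
    | succ k ih =>
      rw [toList_succ, listEdges_append, ih]
      ext e
      simp only [Nat.lt_succ_iff_lt_or_eq, or_and_right, exists_or]
      simp [listEdges, toList]
  rw [key]
  ext e
  constructor
  · rintro ⟨i, -, c, h⟩
    exact ⟨_, c, h⟩
  · rintro ⟨j, c, h⟩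
    obtain ⟨i, hi, rfl⟩ := exists_lt_eq_add b j
    exact ⟨i, hi, c, h⟩

theorem exists_isForcingSet (h4 : (4 : ZMod n) ≠ 0) (hn : 34 ≤ n) {M : (petersen n).Subgraph}
    (hM : M.IsPerfectMatching) (h2 : IsType2 M) :
    ∃ S, IsForcingSet (petersen n) M S ∧ S.ncard ≤ maxForcing n := by
  obtain ⟨i, L, hL, hML⟩ := h2
  obtain ⟨f, -, hfM⟩ := exists_valid h4 hM
  have hf : toList i f n = wordCells L := by
    obtain ⟨g, hg⟩ := exists_toList_eq i ((length_wordCells L).trans hL)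
    rwa [edgesOf_injective h4 (f := f) (g := g)]
    rw [hfM, hML, cdEdges_eq_listEdges, ← hg, listEdges_toList]
  obtain ⟨A, B, rfl, ps, hps, hforces, hw⟩ := exists_forcesClosed L (hL ▸ hn)
  rw [wordCells_append] at hf
  have hf' := toList_rotate hf
  rw [← wordCells_append] at hf'
  set b := i + ((wordCells A).length : ZMod n)
  obtain ⟨p, hp⟩ := exists_toList_eq (n := n) b (x := ps)
    (by rw [hps.length_eq, ← hf']; simp [toList])
  rw [← hp, ← hf'] at hps
  refine ⟨edgesOf p, ⟨?_, fun M' hM' hS => ?_⟩, ?_⟩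
  · rw [← hfM, edgesOf_subset_iff h4]
    exact sub_toList_iff.1 hps
  · obtain ⟨f', hv, hf'M⟩ := exists_valid h4 hM'
    rw [← hf'M, edgesOf_subset_iff h4] at hS
    have := hforces _ _ (hv.closed_path b) (by rw [← hp]; exact sub_toList_iff.2 hS)
    refine eq_of_edgeSet_eq hM' hM ?_
    rw [← hfM, ← hf'M, toList_injective (this.trans hf'.symm)]
  · rwa [ncard_edgesOf h4, ← totalWeight_toList b, hp, maxForcing, ← hL]

theorem exists_hard_matching (h4 : (4 : ZMod n) ≠ 0) (hn : 34 ≤ n) :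
    ∃ M : (petersen n).Subgraph, M.IsPerfectMatching ∧ IsType2 M ∧
      ∀ S, IsForcingSet (petersen n) M S → maxForcing n ≤ S.ncard := by
  obtain ⟨L, hL, hhard⟩ := exists_hard_word hn
  obtain ⟨f, hf⟩ := exists_toList_eq (0 : ZMod n) ((length_wordCells L).trans hL)
  have hv : Valid f := valid_of_path (s := s₀) (by omega) (by rw [hf]; exact path_wordCells L)
  obtain ⟨M, hM, hMf⟩ := exists_isPerfectMatching h4 hv
  refine ⟨M, hM, ⟨0, L, hL, ?_⟩, fun S hS => ?_⟩
  · rw [hMf, cdEdges_eq_listEdges, ← hf, listEdges_toList]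
  · obtain ⟨p, rfl⟩ := exists_edgesOf_eq h4 (hS.1.trans M.edgeSet_subset)
    by_contra! hlt
    have hsub := hS.1
    rw [hMf, edgesOf_subset_iff h4, ← sub_toList_iff (b := 0), hf] at hsub
    rw [ncard_edgesOf h4, ← totalWeight_toList 0] at hlt
    obtain ⟨s, x, hx, hpx, hne⟩ := hhard _ hsub hlt
    obtain ⟨f', rfl⟩ := exists_toList_eq (0 : ZMod n) (x := x)
      (by rw [← hpx.length_eq]; simp [toList])
    obtain ⟨M', hM', hMf'⟩ := exists_isPerfectMatching h4 (valid_of_path (by omega) hx)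
    have hMM := hS.2 M' hM' (by
      rw [hMf', edgesOf_subset_iff h4]
      exact sub_toList_iff.1 hpx)
    rw [hMM, hMf] at hMf'
    rw [← edgesOf_injective h4 hMf', hf] at hne
    exact hne rfl

end Graph

theorem forcingNumber_le {V : Type*} {G : SimpleGraph V} {M : G.Subgraph} {S : Set (Sym2 V)}
    (hS : IsForcingSet G M S) : forcingNumber G M ≤ S.ncard := Nat.sInf_le ⟨S, hS, rfl⟩

theorem le_forcingNumber {V : Type*} {G : SimpleGraph V} {M : G.Subgraph} {k : ℕ}
    (hne : ∃ S, IsForcingSet G M S) (h : ∀ S, IsForcingSet G M S → k ≤ S.ncard) :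
    k ≤ forcingNumber G M := by
  obtain ⟨S, hS⟩ := hne
  refine le_csInf ⟨_, S, hS, rfl⟩ ?_
  rintro _ ⟨S, hS, rfl⟩
  exact h S hS

end PetersenForcing

/-- for `n ≥ 34` the maximum forcing number over type-2 perfect matchings
of `P(n,2)` equals `⌈(n+3)/7⌉ + δ(n)` (written `(n+9)/7` in natural division), where
`δ(n) = 1` if `n ≡ 3 (mod 7)` and `δ(n) = 0` otherwise. -/
theorem type2_max_forcing (n : ℕ) (hn : 34 ≤ n) :
    IsGreatest {k | ∃ M : (petersen n).Subgraph,
        M.IsPerfectMatching ∧ IsType2 M ∧ forcingNumber (petersen n) M = k}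
      ((n + 9) / 7 + if n % 7 = 3 then 1 else 0) := by
  have : NeZero n := ⟨by omega⟩
  have h4 : (4 : ZMod n) ≠ 0 := by
    intro h
    have := Nat.le_of_dvd (by norm_num) ((ZMod.natCast_eq_zero_iff 4 n).1 (by exact_mod_cast h))
    omega
  constructor
  · obtain ⟨M, hM, h2, hle⟩ := PetersenForcing.exists_hard_matching h4 hn
    obtain ⟨S, hS, hcard⟩ := PetersenForcing.exists_isForcingSet h4 hn hM h2
    exact ⟨M, hM, h2, le_antisymm ((PetersenForcing.forcingNumber_le hS).trans hcard)
      (PetersenForcing.le_forcingNumber ⟨S, hS⟩ hle)⟩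
  · rintro _ ⟨M, hM, h2, rfl⟩
    obtain ⟨S, hS, hcard⟩ := PetersenForcing.exists_isForcingSet h4 hn hM h2
    exact (PetersenForcing.forcingNumber_le hS).trans hcard
end
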